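/- Let μ ∈ 𝓜 with distribution function α, let 0 ≤ s ≤ t ≤ 1 and x ∈ ℝ, and let X be the continuous (𝓕_r)-adapted process satisfying X(r) = x + ∫_s^r α(v)ζ(v) ∂_x Φ_μ(v, X(v)) dv + W(r) − W(s) for r ∈ [s,t]. Then the process ( ∂_x Φ_μ(r, X(r)) )_{s ≤ r ≤ t} is a continuous (𝓕_r)-martingale; in particular, E[ ∂_x Φ_μ(b, X(b)) | 𝓕_a ] = ∂_x Φ_μ(a, X(a)) almost surely for all s ≤ a ≤ b ≤ t. -/

import Mathlib

open MeasureTheory ProbabilityTheory Real Set Filter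

noncomputable section

/-- `ξ(s) = ∑_{p≥2} β_p² s^p` (we use `β : ℕ → ℝ` with `β 0 = β 1 = 0`). -/
def xiFn (β : ℕ → ℝ) (s : ℝ) : ℝ := ∑' p : ℕ, β p ^ 2 * s ^ p

/-- `ξ'(s)`. -/
def xiD (β : ℕ → ℝ) (s : ℝ) : ℝ := ∑' p : ℕ, (p : ℝ) * β p ^ 2 * s ^ (p - 1)

/-- `ζ(s) = ξ''(s)`. -/
def zetaFn (β : ℕ → ℝ) (s : ℝ) : ℝ :=
  ∑' p : ℕ, (p : ℝ) * ((p : ℝ) - 1) * β p ^ 2 * s ^ (p - 2)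

/-- admissible sequence of temperature parameters -/
def ValidBeta (β : ℕ → ℝ) : Prop :=
  β 0 = 0 ∧ β 1 = 0 ∧ (∀ p, 0 ≤ β p) ∧ (∃ p, 2 ≤ p ∧ 0 < β p) ∧
    Summable fun p : ℕ => (2 : ℝ) ^ p * β p ^ 2

/-- membership in `𝓜`: a Borel probability measure concentrated on `[0,1]` -/
def MemM (μ : Measure ℝ) : Prop := IsProbabilityMeasure μ ∧ μ (Icc (0 : ℝ) 1)ᶜ = 0

/-- member of `𝓜_d`: finitely supported -/
def FinSupp (μ : Measure ℝ) : Prop := ∃ S : Finset ℝ, μ ((S : Set ℝ))ᶜ = 0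

/-- the distribution function `α(s) = μ([0,s])` -/
def distF (μ : Measure ℝ) (s : ℝ) : ℝ := (μ (Icc 0 s)).toReal

/-- the metric `d(μ,ν) = ∫_0^1 |μ([0,s]) - ν([0,s])| ds` -/
def dM (μ ν : Measure ℝ) : ℝ := ∫ s in (0 : ℝ)..1, |distF μ s - distF ν s|

/-- the smallest atom of `μ` strictly after `s` (or `1` if there is none) -/
def nextPt (μ : Measure ℝ) (s : ℝ) : ℝ :=
  sInf ({q : ℝ | s < q ∧ q ≤ 1 ∧ μ {q} ≠ 0} ∪ {1})

/-- one step of the backward recursion defining the Parisi PDE solution: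
`(1/m) log E exp (m Φ(t, x + z √(ξ'(t) - ξ'(s))))`, interpreted as
`E Φ(t, x + z √(ξ'(t) - ξ'(s)))` when `m = 0`. -/
def gStep (β : ℕ → ℝ) (Φ : ℝ → ℝ → ℝ) (m t s x : ℝ) : ℝ :=
  if m = 0 then ∫ z, Φ t (x + z * Real.sqrt (xiD β t - xiD β s)) ∂(gaussianReal 0 1)
  else m⁻¹ * Real.log
    (∫ z, Real.exp (m * Φ t (x + z * Real.sqrt (xiD β t - xiD β s))) ∂(gaussianReal 0 1))

/-- `Φ` is the Parisi PDE solution of a finitely supported `μ`. -/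
def IsAtomicSol (β : ℕ → ℝ) (μ : Measure ℝ) (Φ : ℝ → ℝ → ℝ) : Prop :=
  (∀ x : ℝ, Φ 1 x = Real.log (Real.cosh x)) ∧
  (∀ s ∈ Ico (0 : ℝ) 1, ∀ x : ℝ, Φ s x = gStep β Φ (distF μ s) (nextPt μ s) s x)

/-- `Φ` is the Parisi family `μ ↦ Φ_μ`: it satisfies the backward recursion on `𝓜_d`
and is `d`-continuous on `𝓜` (uniformly in `(s,x) ∈ [0,1] × ℝ`). -/
def IsParisiFamily (β : ℕ → ℝ) (Φ : Measure ℝ → ℝ → ℝ → ℝ) : Prop :=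
  (∀ μ, MemM μ → FinSupp μ → IsAtomicSol β μ (Φ μ)) ∧
  (∀ μ, MemM μ → ∀ ε : ℝ, 0 < ε → ∃ δ : ℝ, 0 < δ ∧ ∀ ν, MemM ν → dM μ ν < δ →
      ∀ s ∈ Icc (0 : ℝ) 1, ∀ x : ℝ, |Φ μ s x - Φ ν s x| < ε)

/-- `B` is a standard Brownian motion under `P`. -/
def IsStdBM {Ω : Type*} [MeasurableSpace Ω] (P : Measure Ω) (B : ℝ → Ω → ℝ) : Prop :=
  (∀ t : ℝ, Measurable (B t)) ∧
  (∀ᵐ ω ∂P, B 0 ω = 0) ∧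
  (∀ᵐ ω ∂P, Continuous fun t => B t ω) ∧
  (∀ s t : ℝ, 0 ≤ s → s ≤ t →
    Measure.map (fun ω => B t ω - B s ω) P = gaussianReal 0 (Real.toNNReal (t - s))) ∧
  (∀ s t : ℝ, 0 ≤ s → s ≤ t →
    Indep (MeasurableSpace.comap (fun ω => B t ω - B s ω) inferInstance)
      (⨆ v ∈ Icc (0 : ℝ) s, MeasurableSpace.comap (B v) inferInstance) P)

/-- the space `𝓓[s,t]`: progressively measurable processes bounded by `1` on `[s,t]` -/
def InD {Ω : Type*} {mΩ : MeasurableSpace Ω} (𝓕 : Filtration ℝ mΩ) (s t : ℝ)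
    (u : ℝ → Ω → ℝ) : Prop :=
  ProgMeasurable 𝓕 u ∧ ∀ r ∈ Icc s t, ∀ ω, |u r ω| ≤ 1

/-- the norm `‖u‖ = (E ∫_s^t u(r)² dr)^{1/2}` on `𝓓[s,t]` -/
def normD {Ω : Type*} [MeasurableSpace Ω] (P : Measure Ω) (s t : ℝ)
    (u : ℝ → Ω → ℝ) : ℝ :=
  Real.sqrt (∫ ω, (∫ r in s..t, (u r ω) ^ 2) ∂P)

/-- the functional
`F^{s,t}(u,x) = E[Φ_μ(t, x + ∫_s^t α ζ u dr + W(t) - W(s)) - (1/2)∫_s^t α ζ u² dr]`,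
where `W r = B (ξ' r)`. -/
def Ffn {Ω : Type*} [MeasurableSpace Ω] (P : Measure Ω) (β : ℕ → ℝ) (μ : Measure ℝ)
    (Φ : ℝ → ℝ → ℝ) (W : ℝ → Ω → ℝ) (s t : ℝ) (u : ℝ → Ω → ℝ) (x : ℝ) : ℝ :=
  ∫ ω, (Φ t (x + (∫ r in s..t, distF μ r * zetaFn β r * u r ω) + (W t ω - W s ω))
      - (1 / 2) * ∫ r in s..t, distF μ r * zetaFn β r * (u r ω) ^ 2) ∂P


/-! ### Gaussian averages and the Cole–Hopf step -/

/-- centred Gaussian measure of variance `h` -/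
def pzG (h : ℝ) : Measure ℝ := gaussianReal 0 (Real.toNNReal h)

instance pzG_prob (h : ℝ) : IsProbabilityMeasure (pzG h) := by
  unfold pzG; infer_instance

/-- the function `φ_m(g) = (e^{mg}-1)/m` -/
def pzPhi (m g : ℝ) : ℝ := if m = 0 then g else (Real.exp (m * g) - 1) / m

/-- one Cole–Hopf step -/
def pzT (m h : ℝ) (f : ℝ → ℝ) (x : ℝ) : ℝ :=
  if m = 0 then ∫ w, f (x + w) ∂(pzG h)
  else m⁻¹ * Real.log (∫ w, Real.exp (m * f (x + w)) ∂(pzG h))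

/-- 1-Lipschitz functions -/
def pzLip (f : ℝ → ℝ) : Prop := ∀ x y, |f x - f y| ≤ |x - y|

lemma pzLip.cont {f : ℝ → ℝ} (hf : pzLip f) : Continuous f := by
  have : LipschitzWith 1 f := LipschitzWith.of_dist_le_mul (by
    intro x y; simpa [Real.dist_eq] using hf x y)
  exact this.continuous

lemma pz_int_exp_abs (h k : ℝ) : Integrable (fun w => Real.exp (k * |w|)) (pzG h) := by
  have h1 : Integrable (fun w => Real.exp (k * w) + Real.exp (-k * w)) (pzG h) :=
    (integrable_exp_mul_gaussianReal k).add (integrable_exp_mul_gaussianReal (-k))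
  refine h1.mono' (by fun_prop) (Eventually.of_forall fun w => ?_)
  rw [Real.norm_eq_abs, abs_of_pos (Real.exp_pos _)]
  rcases abs_cases w with ⟨e, _⟩ | ⟨e, _⟩ <;> rw [e]
  · linarith [Real.exp_pos (-k * w)]
  · rw [show k * -w = -k * w by ring]; linarith [Real.exp_pos (k * w)]

lemma pz_int_dom {h C k : ℝ} {F : ℝ → ℝ} (hF : Continuous F)
    (hb : ∀ w, |F w| ≤ C * Real.exp (k * |w|)) : Integrable F (pzG h) :=
  ((pz_int_exp_abs h k).const_mul C).mono' hF.aestronglyMeasurable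
    (Eventually.of_forall fun w => by simpa using hb w)

lemma pzLip.int_exp {f : ℝ → ℝ} (hf : pzLip f) (m h x : ℝ) :
    Integrable (fun w => Real.exp (m * f (x + w))) (pzG h) := by
  have hc := hf.cont
  refine pz_int_dom (C := Real.exp (m * f x)) (k := |m|) (by fun_prop) fun w => ?_
  rw [abs_of_pos (Real.exp_pos _), ← Real.exp_add]
  apply Real.exp_le_exp.2
  have h1 := hf (x + w) x
  rw [add_sub_cancel_left] at h1
  have h2 : m * (f (x + w) - f x) ≤ |m| * |w| := by
    calc _ ≤ |m * (f (x + w) - f x)| := le_abs_self _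
      _ = |m| * |f (x + w) - f x| := abs_mul _ _
      _ ≤ _ := by gcongr
  linarith

lemma pzLip.int {f : ℝ → ℝ} (hf : pzLip f) (h x : ℝ) :
    Integrable (fun w => f (x + w)) (pzG h) := by
  have hc := hf.cont
  refine pz_int_dom (C := |f x| + 1) (k := 1) (by fun_prop) fun w => ?_
  have h1 := hf (x + w) x
  rw [add_sub_cancel_left] at h1
  have h2 : |f (x + w)| ≤ |f x| + |w| := by
    have := abs_add_le (f (x + w) - f x) (f x)
    rw [sub_add_cancel] at this
    linarith
  have h3 := Real.add_one_le_exp (1 * |w|)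
  have h4 : 0 ≤ |w| := abs_nonneg w
  have h5 : 0 ≤ |f x| := abs_nonneg _
  nlinarith

lemma pzLip.int_phi {f : ℝ → ℝ} (hf : pzLip f) (m h x c : ℝ) :
    Integrable (fun w => pzPhi m (f (x + w) - c)) (pzG h) := by
  unfold pzPhi
  split_ifs with hm
  · exact (hf.int h x).sub (integrable_const c)
  · have : (fun w => (Real.exp (m * (f (x + w) - c)) - 1) / m)
        = fun w => (Real.exp (m * f (x + w)) * Real.exp (- (m * c)) - 1) / m := by
      funext w; rw [← Real.exp_add]; ring_nf
    rw [this]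
    exact (((hf.int_exp m h x).mul_const _).sub (integrable_const 1)).div_const m

lemma pzLip.exp_pos {f : ℝ → ℝ} (hf : pzLip f) (m h x : ℝ) :
    0 < ∫ w, Real.exp (m * f (x + w)) ∂(pzG h) :=
  integral_exp_pos (hf.int_exp m h x)

lemma pzLip.exp_T {f : ℝ → ℝ} (hf : pzLip f) {m : ℝ} (hm : m ≠ 0) (h x : ℝ) :
    Real.exp (m * pzT m h f x) = ∫ w, Real.exp (m * f (x + w)) ∂(pzG h) := by
  rw [pzT, if_neg hm, mul_inv_cancel_left₀ hm, Real.exp_log (hf.exp_pos m h x)]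

lemma pzLip.int_phi_eq {f : ℝ → ℝ} (hf : pzLip f) (m h x c : ℝ) :
    ∫ w, pzPhi m (f (x + w) - c) ∂(pzG h) = pzPhi m (pzT m h f x - c) := by
  by_cases hm : m = 0
  · subst hm
    simp only [pzPhi, pzT, if_true]
    rw [integral_sub (hf.int h x) (integrable_const c)]; simp
  · have e : (fun w => pzPhi m (f (x + w) - c))
        = fun w => (Real.exp (m * f (x + w)) * Real.exp (- (m * c)) - 1) / m := by
      funext w; rw [← Real.exp_add, pzPhi, if_neg hm]; ring_nf
    rw [e, integral_div, integral_sub ((hf.int_exp m h x).mul_const _) (integrable_const 1),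
      integral_mul_const, ← hf.exp_T hm, ← Real.exp_add, pzPhi, if_neg hm]
    simp; ring_nf

lemma pzPhi_mono {m : ℝ} (hm : 0 ≤ m) : StrictMono (pzPhi m) := by
  intro a b hab
  unfold pzPhi
  split_ifs with h
  · exact hab
  · have hm' : 0 < m := lt_of_le_of_ne hm (Ne.symm h)
    gcongr

lemma pzPhi_zero (m : ℝ) : pzPhi m 0 = 0 := by simp [pzPhi]

lemma pzPhi_nonneg {m g : ℝ} (hm : 0 ≤ m) : 0 ≤ pzPhi m g ↔ 0 ≤ g := by
  have := (pzPhi_mono hm).le_iff_le (a := 0) (b := g)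
  rwa [pzPhi_zero] at this
lemma pzPhi_nonpos {m g : ℝ} (hm : 0 ≤ m) : pzPhi m g ≤ 0 ↔ g ≤ 0 := by
  have := (pzPhi_mono hm).le_iff_le (a := g) (b := 0)
  rwa [pzPhi_zero] at this

lemma pzLip.T_le {f : ℝ → ℝ} (hf : pzLip f) {m : ℝ} (hm : 0 ≤ m) (h x c : ℝ) :
    pzT m h f x ≤ c ↔ ∫ w, pzPhi m (f (x + w) - c) ∂(pzG h) ≤ 0 := by
  rw [hf.int_phi_eq, pzPhi_nonpos hm, sub_nonpos]
lemma pzLip.le_T {f : ℝ → ℝ} (hf : pzLip f) {m : ℝ} (hm : 0 ≤ m) (h x c : ℝ) :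
    c ≤ pzT m h f x ↔ 0 ≤ ∫ w, pzPhi m (f (x + w) - c) ∂(pzG h) := by
  rw [hf.int_phi_eq, pzPhi_nonneg hm, sub_nonneg]
lemma pzLip.phi_T {f : ℝ → ℝ} (hf : pzLip f) (m h x : ℝ) :
    ∫ w, pzPhi m (f (x + w) - pzT m h f x) ∂(pzG h) = 0 := by
  rw [hf.int_phi_eq, sub_self, pzPhi_zero]

/-- general comparison -/
lemma pz_comp {f g : ℝ → ℝ} (hf : pzLip f) (hg : pzLip g) {m : ℝ} (hm : 0 ≤ m) (h x y c : ℝ)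
    (H : ∀ w, f (x + w) ≤ g (y + w) + c) : pzT m h f x ≤ pzT m h g y + c := by
  rw [hf.T_le hm, ← hg.phi_T m h y]
  refine integral_mono (hf.int_phi _ _ _ _) (hg.int_phi _ _ _ _) fun w => ?_
  apply (pzPhi_mono hm).monotone
  linarith [H w]

lemma pz_T_lip {f : ℝ → ℝ} (hf : pzLip f) {m : ℝ} (hm : 0 ≤ m) (h : ℝ) : pzLip (pzT m h f) := by
  have key : ∀ x y, pzT m h f x ≤ pzT m h f y + |x - y| := fun x y =>
    pz_comp hf hf hm h x y _ fun w => by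
      have := hf (x + w) (y + w)
      rw [add_sub_add_right_eq_sub] at this
      linarith [le_abs_self (f (x + w) - f (y + w))]
  intro x y
  rw [abs_le]
  have h1 := key x y
  have h2 := key y x
  rw [abs_sub_comm] at h2
  constructor <;> linarith

lemma pzPhi_mono_m {m M : ℝ} (hm : 0 ≤ m) (hmM : m ≤ M) (g : ℝ) : pzPhi m g ≤ pzPhi M g := by
  unfold pzPhi
  split_ifs with h1 h2 h2
  · exact le_rfl
  · have hM : 0 < M := lt_of_le_of_ne (hm.trans hmM) (Ne.symm h2)
    rw [le_div_iff₀ hM]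
    linarith [Real.add_one_le_exp (M * g)]
  · exact absurd (le_antisymm (h2 ▸ hmM) hm) h1
  · have hm' : 0 < m := lt_of_le_of_ne hm (Ne.symm h1)
    have hM : 0 < M := hm'.trans_le hmM
    have hc := convexOn_exp.2 (mem_univ (M * g)) (mem_univ 0)
      (div_nonneg hm hM.le) (sub_nonneg.2 ((div_le_one hM).2 hmM)) (by ring)
    simp only [smul_eq_mul, mul_zero, add_zero, Real.exp_zero, mul_one] at hc
    rw [show m / M * (M * g) = m * g by field_simp] at hc
    rw [div_le_div_iff₀ hm' hM]
    have : Real.exp (m * g) - 1 ≤ m / M * (Real.exp (M * g) - 1) := by linarith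
    calc _ ≤ m / M * (Real.exp (M * g) - 1) * M := by gcongr
      _ = _ := by field_simp

lemma pz_T_mono_m {f : ℝ → ℝ} (hf : pzLip f) {m M : ℝ} (hm : 0 ≤ m) (hmM : m ≤ M) (h x : ℝ) :
    pzT m h f x ≤ pzT M h f x := by
  rw [hf.T_le hm, ← hf.phi_T M h x]
  exact integral_mono (hf.int_phi _ _ _ _) (hf.int_phi _ _ _ _) fun w => pzPhi_mono_m hm hmM _

lemma pz_conv {F : ℝ → ℝ} {h k : ℝ} (hh : 0 ≤ h) (hk : 0 ≤ k)
    (hF : Integrable F (pzG (h + k))) :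
    ∫ w, F w ∂(pzG (h + k)) = ∫ w, ∫ v, F (w + v) ∂(pzG k) ∂(pzG h) := by
  have e : pzG (h + k) = (pzG h).conv (pzG k) := by
    unfold pzG
    rw [gaussianReal_conv_gaussianReal, add_zero, Real.toNNReal_add hh hk]
  rw [e] at hF ⊢
  exact integral_conv hF

lemma pz_semigroup {f : ℝ → ℝ} (hf : pzLip f) (m : ℝ) {h k : ℝ} (hh : 0 ≤ h) (hk : 0 ≤ k) (x : ℝ) :
    pzT m h (pzT m k f) x = pzT m (h + k) f x := by
  by_cases hm : m = 0
  · subst hm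
    have := pz_conv hh hk (hf.int (h + k) x)
    simp only [pzT, if_true, this, add_assoc]
  · have := pz_conv hh hk (hf.int_exp m (h + k) x)
    have e2 := fun w => hf.exp_T hm k (x + w)
    rw [pzT, if_neg hm]
    simp_rw [e2]
    rw [pzT, if_neg hm, this]
    simp only [add_assoc]



/-! ### The invariant class of functions -/

/-- convex, 1-Lipschitz functions with `(e^f)'' ≤ e^f` in difference form -/
structure pzC (f : ℝ → ℝ) : Prop where
  conv : ConvexOn ℝ univ f
  lip : pzLip f
  ex : ∀ x d, Real.exp (f (x + d)) + Real.exp (f (x - d)) ≤ 2 * Real.cosh d * Real.exp (f x)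

lemma pzPhi_convex {m : ℝ} (hm : 0 ≤ m) : ConvexOn ℝ univ (pzPhi m) := by
  refine ⟨convex_univ, fun x _ y _ a b ha hb hab => ?_⟩
  unfold pzPhi
  split_ifs with h
  · exact le_rfl
  · have hm' : 0 < m := lt_of_le_of_ne hm (Ne.symm h)
    have := convexOn_exp.2 (mem_univ (m * x)) (mem_univ (m * y)) ha hb hab
    simp only [smul_eq_mul] at this ⊢
    rw [show m * (a * x + b * y) = a * (m * x) + b * (m * y) by ring,
      show a * ((Real.exp (m * x) - 1) / m) + b * ((Real.exp (m * y) - 1) / m)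
        = (a * Real.exp (m * x) + b * Real.exp (m * y) - (a + b)) / m by ring, hab]
    gcongr

/-- concavity of `v ↦ φ_m (log v)` for `m ≤ 1`, in exponential coordinates -/
lemma pzPhi_log_concave {m : ℝ} (hm : 0 ≤ m) (hm1 : m ≤ 1) {a b u v : ℝ} (ha : 0 ≤ a) (hb : 0 ≤ b)
    (hab : a + b = 1) :
    a * pzPhi m u + b * pzPhi m v ≤ pzPhi m (Real.log (a * Real.exp u + b * Real.exp v)) := by
  have hpos : 0 < a * Real.exp u + b * Real.exp v := by
    have := Real.exp_pos u
    have := Real.exp_pos v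
    rcases ha.eq_or_lt with h | h
    · subst h
      have : b = 1 := by linarith
      subst this; simpa using Real.exp_pos v
    · positivity
  unfold pzPhi
  split_ifs with h
  · have := strictConcaveOn_log_Ioi.concaveOn.2 (Real.exp_pos u) (Real.exp_pos v) ha hb hab
    simpa using this
  · have hm' : 0 < m := lt_of_le_of_ne hm (Ne.symm h)
    have := (Real.concaveOn_rpow hm hm1).2 (Real.exp_pos u).le (Real.exp_pos v).le ha hb hab
    simp only [smul_eq_mul, Real.rpow_def_of_pos (Real.exp_pos _), Real.log_exp] at this
    rw [Real.rpow_def_of_pos hpos] at this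
    rw [show a * ((Real.exp (m * u) - 1) / m) + b * ((Real.exp (m * v) - 1) / m)
        = (a * Real.exp (m * u) + b * Real.exp (m * v) - (a + b)) / m by ring, hab]
    rw [mul_comm u, mul_comm v, mul_comm (Real.log _)] at this
    gcongr

lemma pz_T_cls {f : ℝ → ℝ} (hf : pzC f) {m : ℝ} (hm : 0 ≤ m) (hm1 : m ≤ 1) (h : ℝ) :
    pzC (pzT m h f) := by
  have hl := hf.lip
  refine ⟨⟨convex_univ, fun x _ y _ a b ha hb hab => ?_⟩, pz_T_lip hl hm h, fun x d => ?_⟩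
  · simp only [smul_eq_mul]
    rw [hl.T_le hm]
    have e : a * (∫ w, pzPhi m (f (x + w) - pzT m h f x) ∂(pzG h))
        + b * (∫ w, pzPhi m (f (y + w) - pzT m h f y) ∂(pzG h)) = 0 := by
      rw [hl.phi_T, hl.phi_T]; simp
    rw [← integral_const_mul, ← integral_const_mul, ← integral_add
      ((hl.int_phi _ _ _ _).const_mul _) ((hl.int_phi _ _ _ _).const_mul _)] at e
    rw [← e]
    refine integral_mono (hl.int_phi _ _ _ _) (((hl.int_phi _ _ _ _).const_mul _).add
      ((hl.int_phi _ _ _ _).const_mul _)) fun w => ?_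
    have h1 := hf.conv.2 (mem_univ (x + w)) (mem_univ (y + w)) ha hb hab
    have h2 := (pzPhi_convex hm).2 (mem_univ (f (x + w) - pzT m h f x))
      (mem_univ (f (y + w) - pzT m h f y)) ha hb hab
    simp only [smul_eq_mul] at h1 h2
    refine le_trans ((pzPhi_mono hm).monotone ?_) h2
    rw [show a * (x + w) + b * (y + w) = a * x + b * y + (a + b) * w by ring, hab, one_mul] at h1
    linarith
  · set p := pzT m h f (x + d) with hp
    set q := pzT m h f (x - d) with hq
    have hS : 0 < Real.exp p + Real.exp q := by positivity
    have hcd : 0 < 2 * Real.cosh d := by have := Real.cosh_pos d; positivity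
    set a := Real.exp p / (Real.exp p + Real.exp q) with ha
    set b := Real.exp q / (Real.exp p + Real.exp q) with hb
    have ha0 : 0 ≤ a := by positivity
    have hb0 : 0 ≤ b := by positivity
    have hab : a + b = 1 := by rw [ha, hb]; field_simp
    set c := Real.log ((Real.exp p + Real.exp q) / (2 * Real.cosh d)) with hc
    have hec : Real.exp c = (Real.exp p + Real.exp q) / (2 * Real.cosh d) :=
      Real.exp_log (by positivity)
    have key : c ≤ pzT m h f x := by
      rw [hl.le_T hm]
      have e : a * (∫ w, pzPhi m (f (x + d + w) - p) ∂(pzG h))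
          + b * (∫ w, pzPhi m (f (x - d + w) - q) ∂(pzG h)) = 0 := by
        rw [hl.phi_T, hl.phi_T]; simp
      rw [← integral_const_mul, ← integral_const_mul, ← integral_add
        ((hl.int_phi _ _ _ _).const_mul _) ((hl.int_phi _ _ _ _).const_mul _)] at e
      rw [← e]
      refine integral_mono (((hl.int_phi _ _ _ _).const_mul _).add
        ((hl.int_phi _ _ _ _).const_mul _)) (hl.int_phi _ _ _ _) fun w => ?_
      refine le_trans (pzPhi_log_concave hm hm1 ha0 hb0 hab) ((pzPhi_mono hm).monotone ?_)
      have hx := hf.ex (x + w) d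
      rw [show x + w + d = x + d + w by ring, show x + w - d = x - d + w by ring] at hx
      have hle : a * Real.exp (f (x + d + w) - p) + b * Real.exp (f (x - d + w) - q)
          = (Real.exp (f (x + d + w)) + Real.exp (f (x - d + w))) / (Real.exp p + Real.exp q) := by
        rw [Real.exp_sub, Real.exp_sub, ha, hb]; field_simp
      rw [hle, Real.log_le_iff_le_exp (by positivity), Real.exp_sub, hec, div_div_eq_mul_div]
      gcongr
      linarith
    have := Real.exp_le_exp.2 key
    rw [hec, div_le_iff₀ hcd] at this
    linarith

lemma pz_logcosh : pzC (fun x => Real.log (Real.cosh x)) := by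
  have hex : ∀ x, Real.exp (Real.log (Real.cosh x)) = Real.cosh x := fun x =>
    Real.exp_log (Real.cosh_pos x)
  have hup : ∀ x d, Real.log (Real.cosh (x + d)) ≤ Real.log (Real.cosh x) + |d| := by
    intro x d
    rw [Real.log_le_iff_le_exp (Real.cosh_pos _), Real.exp_add, hex]
    rw [Real.cosh_eq, Real.cosh_eq]
    have e1 : Real.exp (x + d) ≤ Real.exp x * Real.exp |d| := by
      rw [← Real.exp_add]; apply Real.exp_le_exp.2; linarith [le_abs_self d]
    have e2 : Real.exp (-(x + d)) ≤ Real.exp (-x) * Real.exp |d| := by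
      rw [← Real.exp_add]; apply Real.exp_le_exp.2; linarith [neg_abs_le d]
    linarith
  refine ⟨⟨convex_univ, fun x _ y _ a b ha hb hab => ?_⟩, fun x y => ?_, fun x d => ?_⟩
  · simp only [smul_eq_mul]
    rw [Real.log_le_iff_le_exp (Real.cosh_pos _)]
    set P := Real.log (Real.cosh x)
    set Q := Real.log (Real.cosh y)
    have e1 := convexOn_exp.2 (mem_univ (x - P)) (mem_univ (y - Q)) ha hb hab
    have e2 := convexOn_exp.2 (mem_univ (-x - P)) (mem_univ (-y - Q)) ha hb hab
    simp only [smul_eq_mul] at e1 e2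
    have f1 : Real.exp (x - P) + Real.exp (-x - P) = 2 := by
      rw [Real.exp_sub, Real.exp_sub, hex, ← add_div, Real.cosh_eq]
      field_simp
    have f2 : Real.exp (y - Q) + Real.exp (-y - Q) = 2 := by
      rw [Real.exp_sub, Real.exp_sub, hex, ← add_div, Real.cosh_eq]
      field_simp
    have e3 : Real.exp (a * (x - P) + b * (y - Q)) + Real.exp (a * (-x - P) + b * (-y - Q)) ≤ 2 := by
      have : a * (Real.exp (x - P) + Real.exp (-x - P)) + b * (Real.exp (y - Q) + Real.exp (-y - Q))
        = 2 := by rw [f1, f2]; linarith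
      linarith
    have e4 : Real.exp (a * (x - P) + b * (y - Q)) * Real.exp (a * P + b * Q)
        = Real.exp (a * x + b * y) := by rw [← Real.exp_add]; ring_nf
    have e5 : Real.exp (a * (-x - P) + b * (-y - Q)) * Real.exp (a * P + b * Q)
        = Real.exp (-(a * x + b * y)) := by rw [← Real.exp_add]; ring_nf
    have := mul_le_mul_of_nonneg_right e3 (Real.exp_pos (a * P + b * Q)).le
    rw [add_mul, e4, e5] at this
    rw [Real.cosh_eq]
    linarith
  · have h1 := hup x (y - x)
    have h2 := hup y (x - y)
    rw [add_sub_cancel] at h1 h2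
    rw [abs_sub_comm] at h1
    rw [abs_le]; constructor <;> linarith
  · rw [hex, hex, hex, Real.cosh_add, Real.cosh_sub]
    linarith

lemma pzC.semi {f : ℝ → ℝ} (hf : pzC f) (x d : ℝ) : f (x + d) + f (x - d) - 2 * f x ≤ d ^ 2 := by
  have h1 := hf.ex x d
  have h2 := Real.cosh_le_exp_half_sq d
  have h3 : Real.exp (f (x + d)) + Real.exp (f (x - d)) ≤ 2 * Real.exp (d ^ 2 / 2 + f x) := by
    rw [Real.exp_add]
    have := mul_le_mul_of_nonneg_right h2 (Real.exp_pos (f x)).le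
    linarith
  have h4 := convexOn_exp.2 (mem_univ (f (x + d))) (mem_univ (f (x - d)))
    (by norm_num : (0 : ℝ) ≤ 1 / 2) (by norm_num : (0 : ℝ) ≤ 1 / 2) (by norm_num)
  simp only [smul_eq_mul] at h4
  have h5 : Real.exp (1 / 2 * f (x + d) + 1 / 2 * f (x - d)) ≤ Real.exp (d ^ 2 / 2 + f x) := by
    linarith
  have := Real.exp_le_exp.1 h5
  linarith

lemma pzC.subgrad {f : ℝ → ℝ} (hf : pzC f) (x : ℝ) : ∃ g, ∀ y, f x + g * (y - x) ≤ f y := by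
  refine ⟨derivWithin f (Ioi x) x, fun y => ?_⟩
  have hIntg : x ∈ interior (univ : Set ℝ) := by simp
  rcases lt_trichotomy x y with h | h | h
  · have := hf.conv.rightDeriv_le_slope_of_mem_interior hIntg (mem_univ y) h
    rw [slope_def_field, le_div_iff₀ (sub_pos.2 h)] at this
    linarith
  · subst h; simp
  · have h1 := hf.conv.slope_le_leftDeriv_of_mem_interior (mem_univ y) hIntg h
    have h2 := hf.conv.leftDeriv_le_rightDeriv_of_mem_interior hIntg
    have := h1.trans h2
    rw [slope_def_field, div_le_iff₀ (sub_pos.2 h)] at this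
    linarith

lemma pzC.key {f : ℝ → ℝ} (hf : pzC f) (x : ℝ) :
    (∀ y, 0 ≤ f y - f x - deriv f x * (y - x)) ∧
    (∀ y, f y - f x - deriv f x * (y - x) ≤ (y - x) ^ 2) := by
  obtain ⟨g, hg⟩ := hf.subgrad x
  have hup : ∀ y, f y - f x - g * (y - x) ≤ (y - x) ^ 2 := by
    intro y
    have h1 := hf.semi x (y - x)
    have h2 := hg (x - (y - x))
    rw [add_sub_cancel] at h1
    linarith
  have hd : HasDerivAt f g x := by
    rw [hasDerivAt_iff_isLittleO]
    have h1 : (fun y => f y - f x - (y - x) • g) =O[nhds x] fun y => (y - x) ^ 2 := by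
      refine Asymptotics.IsBigO.of_bound 1 (Eventually.of_forall fun y => ?_)
      rw [one_mul, Real.norm_eq_abs, Real.norm_eq_abs, abs_le, abs_of_nonneg (sq_nonneg (y - x))]
      have := hg y
      have := hup y
      have := sq_nonneg (y - x)
      simp only [smul_eq_mul]
      constructor <;> nlinarith
    refine h1.trans_isLittleO ?_
    simpa using Asymptotics.isLittleO_pow_sub_sub x (m := 2) (by norm_num)
  rw [hd.deriv]
  exact ⟨fun y => by have := hg y; linarith, hup⟩

lemma pzC.deriv_le {f : ℝ → ℝ} (hf : pzC f) (x : ℝ) : |deriv f x| ≤ 1 := by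
  have : LipschitzWith 1 f := LipschitzWith.of_dist_le_mul (by
    intro x y; simpa [Real.dist_eq] using hf.lip x y)
  simpa using norm_deriv_le_of_lipschitz this (x₀ := x)

lemma pz_deriv_close {f g : ℝ → ℝ} (hf : pzC f) (hg : pzC g) {x h e : ℝ}
    (hu : ∀ z, f z - g z ∈ Icc 0 h) (he : 0 < e) :
    |deriv f x - deriv g x| ≤ h / e + e := by
  have k1 := fun z => (hf.key x).1 z
  have k2 := fun z => (hg.key x).2 z
  have gen : ∀ d, (deriv f x - deriv g x) * d ≤ h + d ^ 2 := by
    intro d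
    have a1 := k1 (x + d)
    have a2 := k2 (x + d)
    rw [add_sub_cancel_left] at a1 a2
    have b1 := hu (x + d)
    have b2 := hu x
    linarith [b1.1, b1.2, b2.1, b2.2]
  have g1 := gen e
  have g2 := gen (-e)
  have : h / e + e = (h + e ^ 2) / e := by field_simp
  rw [this, abs_le, le_div_iff₀ he, neg_le, le_div_iff₀ he]
  constructor <;> linarith

lemma pzC.deriv_lip {f : ℝ → ℝ} (hf : pzC f) (x y : ℝ) : |deriv f x - deriv f y| ≤ 2 * |x - y| := by
  have gen : ∀ d, (deriv f x - deriv f y) * d ≤ (y - x) ^ 2 + d ^ 2 := by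
    intro d
    have a1 := (hf.key x).1 (y + d)
    have a2 := (hf.key y).2 (y + d)
    have a3 := (hf.key x).2 y
    rw [add_sub_cancel_left] at a2
    linarith
  by_cases h : x = y
  · subst h; simp
  have hpos : 0 < |x - y| := abs_pos.2 (sub_ne_zero.2 h)
  have hsq : (y - x) ^ 2 = |x - y| ^ 2 := by rw [sq_abs]; ring
  have g1 := gen |x - y|
  have g2 := gen (-|x - y|)
  rw [hsq] at g1 g2
  rw [abs_le]
  constructor <;> nlinarith

lemma pzC.deriv_cont {f : ℝ → ℝ} (hf : pzC f) : Continuous (deriv f) := by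
  have : LipschitzWith 2 (deriv f) := LipschitzWith.of_dist_le_mul (by
    intro x y; simpa [Real.dist_eq] using hf.deriv_lip x y)
  exact this.continuous

/-- closedness under pointwise limits -/
lemma pzC.lim {f : ℝ → ℝ} {F : ℕ → ℝ → ℝ} (hF : ∀ n, pzC (F n))
    (hlim : ∀ x, Tendsto (fun n => F n x) atTop (nhds (f x))) : pzC f := by
  refine ⟨⟨convex_univ, fun x _ y _ a b ha hb hab => ?_⟩, fun x y => ?_, fun x d => ?_⟩
  · exact le_of_tendsto_of_tendsto' (hlim _) (((hlim x).const_mul a).add ((hlim y).const_mul b))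
      fun n => by simpa using (hF n).conv.2 (mem_univ x) (mem_univ y) ha hb hab
  · exact le_of_tendsto' ((hlim x).sub (hlim y)).abs fun n => (hF n).lip x y
  · exact le_of_tendsto_of_tendsto' (((Real.continuous_exp.tendsto _).comp (hlim _)).add
      ((Real.continuous_exp.tendsto _).comp (hlim _)))
      (((Real.continuous_exp.tendsto _).comp (hlim _)).const_mul _) fun n => (hF n).ex x d



/-! ### Bounds and second order expansion of a Cole–Hopf step -/

lemma pz_scale {h : ℝ} (hh : 0 ≤ h) {F : ℝ → ℝ} (hF : Continuous F) :
    ∫ w, F w ∂(pzG h) = ∫ z, F (z * Real.sqrt h) ∂(gaussianReal 0 1) := by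
  have e : pzG h = (gaussianReal 0 1).map (fun z => z * Real.sqrt h) := by
    rw [gaussianReal_map_mul_const, pzG]
    congr 1
    · simp
    · ext; simp [Real.sq_sqrt hh, hh]
  rw [e, integral_map (by fun_prop) hF.aestronglyMeasurable]

lemma pzG_one : pzG 1 = gaussianReal 0 1 := by simp [pzG]

lemma pz_int_id (h : ℝ) : Integrable (fun w : ℝ => w) (pzG h) := by
  have := (memLp_id_gaussianReal (μ := 0) (v := Real.toNNReal h) 1).integrable (by simp)
  exact this

lemma pz_mean (h : ℝ) : ∫ w, w ∂(pzG h) = 0 := by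
  unfold pzG; simp

lemma pz_int_sq (h : ℝ) : Integrable (fun w : ℝ => w ^ 2) (pzG h) := by
  have := (memLp_id_gaussianReal (μ := 0) (v := Real.toNNReal h) 2).integrable_sq
  exact this

lemma pz_var {h : ℝ} (hh : 0 ≤ h) : ∫ w, w ^ 2 ∂(pzG h) = h := by
  have h1 := variance_fun_id_gaussianReal (μ := 0) (v := Real.toNNReal h)
  rw [variance_eq_integral (by fun_prop)] at h1
  simp only [integral_id_gaussianReal, sub_zero] at h1
  rw [pzG, h1, Real.coe_toNNReal _ hh]

lemma pz_neg {h : ℝ} {F : ℝ → ℝ} (hF : Continuous F) :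
    ∫ w, F w ∂(pzG h) = ∫ w, F (-w) ∂(pzG h) := by
  have e : pzG h = (pzG h).map (fun w => -w) := by
    unfold pzG; rw [gaussianReal_map_neg, neg_zero]
  conv_lhs => rw [e]
  rw [integral_map (by fun_prop) hF.aestronglyMeasurable]

lemma pz_mgf {h : ℝ} (hh : 0 ≤ h) (k : ℝ) : ∫ w, Real.exp (k * w) ∂(pzG h) = Real.exp (h * k ^ 2 / 2) := by
  have := congrFun (mgf_fun_id_gaussianReal (μ := 0) (v := Real.toNNReal h)) k
  simp only [mgf] at this
  rw [pzG, this]; simp [hh]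

lemma pz_T_lower {f : ℝ → ℝ} (hf : pzC f) {m : ℝ} (hm : 0 ≤ m) (h x : ℝ) :
    f x ≤ pzT m h f x := by
  refine le_trans ?_ (pz_T_mono_m hf.lip le_rfl hm h x)
  rw [pzT, if_pos rfl]
  calc f x = ∫ w, (f x + deriv f x * w) ∂(pzG h) := by
        rw [integral_add (integrable_const _) ((pz_int_id h).const_mul _), integral_const_mul,
          pz_mean]; simp
    _ ≤ _ := by
      refine integral_mono ((integrable_const _).add ((pz_int_id h).const_mul _))
        (hf.lip.int h x) fun w => ?_
      have := (hf.key x).1 (x + w)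
      rw [add_sub_cancel_left] at this
      simp only
      linarith

lemma pz_T_upper {f : ℝ → ℝ} (hf : pzC f) {m : ℝ} (hm : 0 ≤ m) (hm1 : m ≤ 1) {h : ℝ} (hh : 0 ≤ h)
    (x : ℝ) : pzT m h f x ≤ f x + h / 2 := by
  refine le_trans (pz_T_mono_m hf.lip hm hm1 h x) ?_
  rw [pzT, if_neg one_ne_zero, inv_one, one_mul]
  simp only [one_mul]
  have hi : Integrable (fun w => Real.exp (f (x + w))) (pzG h) := by
    simpa using hf.lip.int_exp 1 h x
  have hc := hf.lip.cont
  have hi2 : Integrable (fun w => Real.exp (f (x - w))) (pzG h) := by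
    have hl : pzLip (fun y => f (-y)) := fun a b => by
      have := hf.lip (-a) (-b)
      rwa [show -a - -b = -(a - b) by ring, abs_neg] at this
    have := hl.int_exp 1 h (-x)
    refine this.congr (Eventually.of_forall fun w => ?_)
    simp only; ring_nf
  rw [Real.log_le_iff_le_exp (by simpa using hf.lip.exp_pos 1 h x)]
  have e1 : ∫ w, Real.exp (f (x + w)) ∂(pzG h) = ∫ w, Real.exp (f (x - w)) ∂(pzG h) :=
    pz_neg (F := fun w => Real.exp (f (x + w))) (by fun_prop)
  have e2 : ∫ w, (Real.exp (f (x + w)) + Real.exp (f (x - w))) ∂(pzG h)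
      ≤ ∫ w, (Real.exp (1 * w) + Real.exp (-1 * w)) * Real.exp (f x) ∂(pzG h) := by
    refine integral_mono (hi.add hi2) (Integrable.mul_const
      ((integrable_exp_mul_gaussianReal 1).add (integrable_exp_mul_gaussianReal (-1))) _)
      fun w => ?_
    have := hf.ex x w
    rw [Real.cosh_eq] at this
    simp only
    rw [one_mul, neg_one_mul]
    linarith
  have e3 := integral_add (μ := pzG h) (integrable_exp_mul_gaussianReal (μ := 0) (v := Real.toNNReal h) 1)
    (integrable_exp_mul_gaussianReal (μ := 0) (v := Real.toNNReal h) (-1))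
  rw [integral_add hi hi2, ← e1, integral_mul_const, e3, pz_mgf hh, pz_mgf hh] at e2
  rw [Real.exp_add]
  norm_num at e2
  linarith

lemma pz_exp_taylor (v : ℝ) : |Real.exp v - 1 - v - v ^ 2 / 2| ≤ |v| ^ 3 * Real.exp |v| := by
  have h := Complex.norm_exp_sub_sum_le_norm_mul_exp (v : ℂ) 3
  have e : Complex.exp (v : ℂ) - ∑ m ∈ Finset.range 3, (v : ℂ) ^ m / (m.factorial : ℂ)
      = ((Real.exp v - 1 - v - v ^ 2 / 2 : ℝ) : ℂ) := by
    simp [Finset.sum_range_succ, Nat.factorial]; ring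
  rw [e, Complex.norm_real, Complex.norm_real] at h
  simpa using h

lemma pzPhi_taylor {m : ℝ} (hm : 0 ≤ m) (hm1 : m ≤ 1) (u : ℝ) :
    |pzPhi m u - u - m / 2 * u ^ 2| ≤ |u| ^ 3 * Real.exp |u| := by
  unfold pzPhi
  split_ifs with h
  · subst h; simp; positivity
  · have hm' : 0 < m := lt_of_le_of_ne hm (Ne.symm h)
    have e : (Real.exp (m * u) - 1) / m - u - m / 2 * u ^ 2
        = (Real.exp (m * u) - 1 - m * u - (m * u) ^ 2 / 2) / m := by field_simp
    rw [e, abs_div, abs_of_pos hm', div_le_iff₀ hm']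
    refine (pz_exp_taylor (m * u)).trans ?_
    rw [abs_mul, abs_of_pos hm', mul_pow]
    have h1 : Real.exp (m * |u|) ≤ Real.exp |u| :=
      Real.exp_le_exp.2 (mul_le_of_le_one_left (abs_nonneg u) hm1)
    have h2 : m ^ 3 ≤ m := by nlinarith [mul_nonneg hm (sub_nonneg.2 hm1)]
    calc m ^ 3 * |u| ^ 3 * Real.exp (m * |u|) ≤ m * |u| ^ 3 * Real.exp |u| := by gcongr
      _ = _ := by ring

/-- the dominating function in the expansion -/
def pzDom (z : ℝ) : ℝ := (|z| + 1) ^ 3 * Real.exp (|z| + 1) + (z ^ 2 + 1) * (2 * |z| + 1)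

/-- the constant in the expansion -/
def pzK : ℝ := ∫ z, pzDom z ∂(gaussianReal 0 1)

lemma pzDom_int : Integrable pzDom (gaussianReal 0 1) := by
  rw [← pzG_one]
  unfold pzDom
  refine pz_int_dom (C := 6 * Real.exp 1 + 18) (k := 4) (by fun_prop) fun z => ?_
  have ha : 0 ≤ |z| := abs_nonneg z
  rw [abs_of_nonneg (by positivity)]
  have h1 : |z| + 1 ≤ Real.exp |z| := Real.add_one_le_exp _
  have h3 : (|z| + 1) ^ 3 ≤ Real.exp (3 * |z|) := by
    rw [show (3 : ℝ) * |z| = ((3 : ℕ) : ℝ) * |z| by norm_num, Real.exp_nat_mul]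
    gcongr
  have h4 : Real.exp (3 * |z|) ≤ Real.exp (4 * |z|) := Real.exp_le_exp.2 (by linarith)
  have e1 : (|z| + 1) ^ 3 * Real.exp (|z| + 1) ≤ Real.exp 1 * Real.exp (4 * |z|) := by
    calc _ ≤ Real.exp (3 * |z|) * Real.exp (|z| + 1) := by gcongr
      _ = _ := by rw [← Real.exp_add, ← Real.exp_add]; ring_nf
  have e2 : (z ^ 2 + 1) * (2 * |z| + 1) ≤ 2 * (|z| + 1) ^ 3 := by
    rw [← sq_abs z]
    nlinarith [mul_nonneg ha ha]
  have := Real.exp_pos 1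
  have := Real.exp_pos (4 * |z|)
  nlinarith

lemma pzK_nonneg : 0 ≤ pzK := integral_nonneg fun z => by unfold pzDom; positivity

lemma pz_expand {f : ℝ → ℝ} (hf : pzC f) {m : ℝ} (hm : 0 ≤ m) (hm1 : m ≤ 1) {h : ℝ} (hh : 0 ≤ h)
    (hh1 : h ≤ 1) (y : ℝ) :
    |pzT m h f y - (∫ w, f (y + w) ∂(pzG h)) - m / 2 * h * deriv f y ^ 2|
      ≤ pzK * (h * Real.sqrt h) := by
  set c := pzT m h f y with hc
  set d := deriv f y with hd
  have hcl := pz_T_lower hf hm h y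
  have hcu := pz_T_upper hf hm hm1 hh y
  rw [← hc] at hcl hcu
  have hl := hf.lip
  have hcont := hl.cont
  have hphic : Continuous (pzPhi m) := by
    unfold pzPhi; split_ifs <;> fun_prop
  have e0 := hl.phi_T m h y
  rw [← hc] at e0
  have e1 : c - (∫ w, f (y + w) ∂(pzG h)) - m / 2 * h * d ^ 2
      = ∫ w, (pzPhi m (f (y + w) - c) - (f (y + w) - c) - m / 2 * d ^ 2 * w ^ 2) ∂(pzG h) := by
    have i0 := hl.int_phi m h y c
    have i2 : Integrable (fun w => f (y + w) - c) (pzG h) := (hl.int h y).sub (integrable_const c)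
    have i3 : Integrable (fun w => pzPhi m (f (y + w) - c) - (f (y + w) - c)) (pzG h) := i0.sub i2
    rw [integral_sub i3 ((pz_int_sq h).const_mul _), integral_sub i0 i2, e0, integral_const_mul,
      pz_var hh, integral_sub (hl.int h y) (integrable_const c)]
    simp; ring
  rw [e1, pz_scale hh (by fun_prop), pzK, ← integral_mul_const, ← Real.norm_eq_abs]
  refine norm_integral_le_of_norm_le (pzDom_int.mul_const _) (Eventually.of_forall fun z => ?_)
  rw [Real.norm_eq_abs]
  set r := Real.sqrt h with hr
  have hr0 : 0 ≤ r := Real.sqrt_nonneg h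
  have hrr : r * r = h := Real.mul_self_sqrt hh
  have hr1 : r ≤ 1 := Real.sqrt_le_one.2 hh1
  set w := z * r with hw
  set u := f (y + w) - c with hu
  have hwabs : |w| = |z| * r := by rw [hw, abs_mul, abs_of_nonneg hr0]
  have k1 := (hf.key y).1 (y + w)
  have k2 := (hf.key y).2 (y + w)
  have k3 := hl (y + w) y
  rw [add_sub_cancel_left] at k1 k2 k3
  rw [← hd] at k1 k2
  have hz := abs_nonneg z
  have hu1 : |u| ≤ r * (|z| + 1) := by
    have : |u| ≤ |w| + h := by
      rw [abs_le] at k3 ⊢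
      constructor <;> linarith [k3.1, k3.2]
    nlinarith
  have t1 := pzPhi_taylor hm hm1 u
  have t2 : |u| ^ 3 * Real.exp |u| ≤ r ^ 3 * ((|z| + 1) ^ 3 * Real.exp (|z| + 1)) := by
    rw [← mul_assoc, ← mul_pow]
    gcongr
    nlinarith
  have hdle := hf.deriv_le y
  rw [← hd] at hdle
  have t3 : |u - d * w| ≤ r ^ 2 * (z ^ 2 + 1) := by
    have : w ^ 2 = r ^ 2 * z ^ 2 := by rw [hw]; ring
    rw [abs_le]
    have : r ^ 2 = h := by rw [sq, hrr]
    have := mul_nonneg hh (sq_nonneg z)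
    constructor <;> nlinarith
  have t4 : |u + d * w| ≤ r * (2 * |z| + 1) := by
    have : |d * w| ≤ |z| * r := by
      rw [abs_mul, hwabs]; exact mul_le_of_le_one_left (by positivity) hdle
    have := abs_add_le u (d * w)
    linarith
  have t5 : |m / 2 * (u ^ 2 - d ^ 2 * w ^ 2)| ≤ r ^ 3 * ((z ^ 2 + 1) * (2 * |z| + 1)) := by
    rw [show u ^ 2 - d ^ 2 * w ^ 2 = (u - d * w) * (u + d * w) by ring, abs_mul, abs_mul,
      abs_of_nonneg (by positivity)]
    calc m / 2 * (|u - d * w| * |u + d * w|)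
        ≤ 1 * ((r ^ 2 * (z ^ 2 + 1)) * (r * (2 * |z| + 1))) := by gcongr; linarith
      _ = _ := by ring
  have := abs_add_le (pzPhi m u - u - m / 2 * u ^ 2) (m / 2 * (u ^ 2 - d ^ 2 * w ^ 2))
  rw [show pzPhi m u - u - m / 2 * u ^ 2 + m / 2 * (u ^ 2 - d ^ 2 * w ^ 2)
    = pzPhi m u - u - m / 2 * d ^ 2 * w ^ 2 by ring] at this
  have e : pzDom z * (h * r) = r ^ 3 * ((|z| + 1) ^ 3 * Real.exp (|z| + 1))
      + r ^ 3 * ((z ^ 2 + 1) * (2 * |z| + 1)) := by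
    unfold pzDom; rw [← hrr]; ring
  rw [e]
  linarith



/-! ### Elementary facts on `ξ'` and `ζ` -/

lemma pz_summ {β : ℕ → ℝ} (hβ : ValidBeta β) :
    Summable fun p : ℕ => (p : ℝ) ^ 2 * β p ^ 2 * (3 / 2) ^ p := by
  obtain ⟨-, -, -, -, hs⟩ := hβ
  have ht : Tendsto (fun n : ℕ => (n : ℝ) ^ 2 * (3 / 4 : ℝ) ^ n) atTop (nhds 0) :=
    tendsto_pow_const_mul_const_pow_of_abs_lt_one 2 (by rw [abs_of_pos] <;> norm_num)
  obtain ⟨K, hK⟩ := ht.bddAbove_range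
  refine Summable.of_nonneg_of_le (fun p => by positivity) (fun p => ?_) (hs.mul_left K)
  have hKp : (p : ℝ) ^ 2 * (3 / 4 : ℝ) ^ p ≤ K := hK ⟨p, rfl⟩
  calc (p : ℝ) ^ 2 * β p ^ 2 * (3 / 2) ^ p
      = ((p : ℝ) ^ 2 * (3 / 4 : ℝ) ^ p) * (2 ^ p * β p ^ 2) := by
        rw [show (3 / 2 : ℝ) = (3 / 4) * 2 by norm_num, mul_pow]; ring
    _ ≤ K * (2 ^ p * β p ^ 2) := by gcongr

lemma pz_term_bound (β : ℕ → ℝ) (p : ℕ) {s : ℝ} (hs : |s| < 3 / 2) :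
    |(p : ℝ) * ((p : ℝ) - 1) * β p ^ 2 * s ^ (p - 2)| ≤ (p : ℝ) ^ 2 * β p ^ 2 * (3 / 2) ^ p := by
  rw [abs_mul, abs_mul, abs_mul, abs_of_nonneg (sq_nonneg (β p)), abs_pow, Nat.abs_cast]
  have h1 : |(p : ℝ) - 1| ≤ p ∨ p = 0 := by
    rcases Nat.eq_zero_or_pos p with h | h
    · exact Or.inr h
    · left
      have : (1 : ℝ) ≤ p := by exact_mod_cast h
      rw [abs_of_nonneg (by linarith)]; linarith
  rcases h1 with h1 | h1
  · have h2 : |s| ^ (p - 2) ≤ (3 / 2 : ℝ) ^ p :=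
      (pow_le_pow_left₀ (abs_nonneg s) hs.le _).trans
        (pow_le_pow_right₀ (by norm_num) (by omega))
    calc _ ≤ (p : ℝ) * p * β p ^ 2 * (3 / 2) ^ p := by gcongr
      _ = _ := by ring
  · subst h1; simp

lemma pz_xi_deriv {β : ℕ → ℝ} (hβ : ValidBeta β) {s : ℝ} (hs : |s| < 3 / 2) :
    HasDerivAt (xiD β) (zetaFn β s) s := by
  have hball : ∀ y : ℝ, y ∈ Metric.ball (0 : ℝ) (3 / 2) ↔ |y| < 3 / 2 := by
    intro y; simp [Real.dist_eq]
  have := hasDerivAt_tsum_of_isPreconnected (𝕜 := ℝ) (pz_summ hβ) (Metric.isOpen_ball (x := (0 : ℝ)) (ε := 3 / 2))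
    (convex_ball (0 : ℝ) (3 / 2)).isPreconnected
    (g := fun (p : ℕ) (s : ℝ) => (p : ℝ) * β p ^ 2 * s ^ (p - 1))
    (g' := fun (p : ℕ) (s : ℝ) => (p : ℝ) * ((p : ℝ) - 1) * β p ^ 2 * s ^ (p - 2))
    (y₀ := 0) (y := s)
    (fun p y _ => by
      have h := ((hasDerivAt_pow (p - 1) y).const_mul ((p : ℝ) * β p ^ 2))
      refine h.congr_deriv ?_
      rcases p with _ | p
      · simp
      · simp only [Nat.add_sub_cancel]
        rw [show p + 1 - 2 = p - 1 by omega]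
        push_cast; ring)
    (fun p y hy => pz_term_bound β p ((hball y).1 hy))
    (by simp) (by
      refine Summable.of_norm_bounded (pz_summ hβ) fun p => ?_
      rcases p with _ | _ | p
      · simp
      · simp
        nlinarith [sq_nonneg (β 1)]
      · simp; positivity)
    ((hball s).2 hs)
  exact this

lemma pz_zeta_nonneg {β : ℕ → ℝ} {s : ℝ} (hs : 0 ≤ s) : 0 ≤ zetaFn β s := by
  refine tsum_nonneg fun p => ?_
  rcases p with _ | p
  · simp
  · have : (0 : ℝ) ≤ ((p + 1 : ℕ) : ℝ) - 1 := by push_cast; simp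
    positivity

lemma pz_abs_lt {s : ℝ} (hs : s ∈ Icc (0 : ℝ) 1) : |s| < 3 / 2 := by
  rw [abs_of_nonneg hs.1]; linarith [hs.2]

lemma pz_zeta_cont {β : ℕ → ℝ} (hβ : ValidBeta β) : ContinuousOn (zetaFn β) (Icc 0 1) := by
  refine continuousOn_tsum (fun p => by fun_prop) (pz_summ hβ) fun p s hs => ?_
  exact pz_term_bound β p (pz_abs_lt hs)

lemma pz_zeta_ii {β : ℕ → ℝ} (hβ : ValidBeta β) {a b : ℝ} (ha : 0 ≤ a) (hab : a ≤ b) (hb : b ≤ 1) :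
    IntervalIntegrable (zetaFn β) volume a b := by
  refine ((pz_zeta_cont hβ).mono ?_).intervalIntegrable
  rw [uIcc_of_le hab]
  exact Icc_subset_Icc ha hb

lemma pz_zeta_int {β : ℕ → ℝ} (hβ : ValidBeta β) {a b : ℝ} (ha : 0 ≤ a) (hab : a ≤ b) (hb : b ≤ 1) :
    ∫ v in a..b, zetaFn β v = xiD β b - xiD β a := by
  refine intervalIntegral.integral_eq_sub_of_hasDerivAt (fun v hv => ?_) (pz_zeta_ii hβ ha hab hb)
  rw [uIcc_of_le hab] at hv
  exact pz_xi_deriv hβ (pz_abs_lt ⟨ha.trans hv.1, hv.2.trans hb⟩)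

lemma pz_xi_mono {β : ℕ → ℝ} (hβ : ValidBeta β) {a b : ℝ} (ha : 0 ≤ a) (hab : a ≤ b) (hb : b ≤ 1) :
    xiD β a ≤ xiD β b := by
  have := pz_zeta_int hβ ha hab hb
  have h2 : 0 ≤ ∫ v in a..b, zetaFn β v :=
    intervalIntegral.integral_nonneg hab fun v hv => pz_zeta_nonneg (ha.trans hv.1)
  linarith

lemma pz_xi_lip {β : ℕ → ℝ} (hβ : ValidBeta β) : ∃ L : ℝ, 0 ≤ L ∧ ∀ a b : ℝ, 0 ≤ a → a ≤ b → b ≤ 1 →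
    xiD β b - xiD β a ≤ L * (b - a) := by
  obtain ⟨L, hL⟩ := isCompact_Icc.exists_bound_of_continuousOn (pz_zeta_cont hβ)
  refine ⟨L, (norm_nonneg _).trans (hL 0 (by simp)), fun a b ha hab hb => ?_⟩
  rw [← pz_zeta_int hβ ha hab hb]
  have := intervalIntegral.norm_integral_le_of_norm_le_const (a := a) (b := b) (f := zetaFn β) (C := L)
    (fun v hv => hL v (by
      rw [uIoc_of_le hab] at hv
      exact ⟨ha.trans hv.1.le, hv.2.trans hb⟩))
  rw [abs_of_nonneg (sub_nonneg.2 hab)] at this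
  exact (le_abs_self _).trans this

lemma pz_xi_nonneg {β : ℕ → ℝ} {a : ℝ} (ha : 0 ≤ a) : 0 ≤ xiD β a :=
  tsum_nonneg fun p => by positivity

/-! ### Distribution functions -/

lemma pz_distF_nonneg (μ : Measure ℝ) (s : ℝ) : 0 ≤ distF μ s := ENNReal.toReal_nonneg

lemma pz_distF_mono {μ : Measure ℝ} (hμ : MemM μ) : Monotone (distF μ) := by
  haveI := hμ.1
  intro a b hab
  exact ENNReal.toReal_mono (measure_ne_top _ _) (measure_mono (Icc_subset_Icc_right hab))

lemma pz_distF_le {μ : Measure ℝ} (hμ : MemM μ) (s : ℝ) : distF μ s ≤ 1 := by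
  haveI := hμ.1
  exact ENNReal.toReal_le_of_le_ofReal zero_le_one (by simpa using prob_le_one)

/-! ### Finitely supported measures -/

lemma pz_next_finite {ν : Measure ℝ} {S : Finset ℝ} (hS : ν ((S : Set ℝ))ᶜ = 0) (s : ℝ) :
    ∀ q, q ∈ ({q : ℝ | s < q ∧ q ≤ 1 ∧ ν {q} ≠ 0} : Set ℝ) → q ∈ S := by
  rintro q ⟨-, -, h⟩
  by_contra hq
  exact h (measure_mono_null (by simpa using hq) hS)

lemma pz_next_mem {ν : Measure ℝ} {S : Finset ℝ} (hS : ν ((S : Set ℝ))ᶜ = 0) (s : ℝ) :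
    nextPt ν s ∈ ({q : ℝ | s < q ∧ q ≤ 1 ∧ ν {q} ≠ 0} ∪ {1} : Set ℝ) := by
  have hf : ({q : ℝ | s < q ∧ q ≤ 1 ∧ ν {q} ≠ 0} ∪ {1} : Set ℝ).Finite :=
    (S.finite_toSet.subset (fun q hq => by simpa using pz_next_finite hS s q hq)).union
      (finite_singleton 1)
  exact Set.Nonempty.csInf_mem ⟨1, by simp⟩ hf

lemma pz_next_bdd (ν : Measure ℝ) (s : ℝ) :
    BddBelow ({q : ℝ | s < q ∧ q ≤ 1 ∧ ν {q} ≠ 0} ∪ {1} : Set ℝ) := by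
  refine ⟨min s 1, ?_⟩
  rintro q (hq | hq)
  · exact (min_le_left _ _).trans hq.1.le
  · rw [mem_singleton_iff] at hq; rw [hq]; exact min_le_right _ _

lemma pz_next_le {ν : Measure ℝ} (s : ℝ) : nextPt ν s ≤ 1 :=
  csInf_le (pz_next_bdd ν s) (by simp)

lemma pz_next_gt {ν : Measure ℝ} {S : Finset ℝ} (hS : ν ((S : Set ℝ))ᶜ = 0) {s : ℝ} (hs : s < 1) :
    s < nextPt ν s := by
  rcases pz_next_mem hS s with h | h
  · exact h.1
  · rw [mem_singleton_iff] at h; rw [h]; exact hs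

lemma pz_next_eq {ν : Measure ℝ} {s v : ℝ} (hsv : s ≤ v) (hv : v < nextPt ν s) :
    nextPt ν v = nextPt ν s := by
  unfold nextPt at hv ⊢
  congr 1
  ext q
  constructor
  · rintro (h | h)
    · exact Or.inl ⟨hsv.trans_lt h.1, h.2⟩
    · exact Or.inr h
  · rintro (h | h)
    · exact Or.inl ⟨hv.trans_le (csInf_le (pz_next_bdd ν s) (Or.inl h)), h.2⟩
    · exact Or.inr h

lemma pz_dist_eq {ν : Measure ℝ} (hν : MemM ν) {S : Finset ℝ} (hS : ν ((S : Set ℝ))ᶜ = 0)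
    {s v : ℝ} (hs0 : 0 ≤ s) (hsv : s ≤ v) (hv : v < nextPt ν s) : distF ν v = distF ν s := by
  haveI := hν.1
  unfold distF
  congr 1
  have hd : Icc 0 v = Icc 0 s ∪ Ioc s v := (Icc_union_Ioc_eq_Icc hs0 hsv).symm
  have hz : ν (Ioc s v) = 0 := by
    have hsub : Ioc s v ⊆ ((S : Set ℝ))ᶜ ∪ ⋃ q ∈ S.filter (fun q => q ∈ Ioc s v), {q} := by
      intro q hq
      by_cases hqS : q ∈ S
      · right
        simp only [mem_iUnion, mem_singleton_iff, Finset.mem_filter]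
        exact ⟨q, ⟨hqS, hq⟩, rfl⟩
      · left; simpa using hqS
    refine measure_mono_null hsub ?_
    rw [measure_union_null_iff]
    refine ⟨hS, ?_⟩
    refine (measure_biUnion_null_iff (Finset.countable_toSet
      (S.filter (fun q => q ∈ Ioc s v)))).2 ?_
    intro q hq
    have hq' := (Finset.mem_filter.1 hq).2
    by_contra hne
    have : nextPt ν s ≤ q := csInf_le (pz_next_bdd ν s)
      (Or.inl ⟨hq'.1, (hq'.2.trans hv.le).trans (pz_next_le s), hne⟩)
    linarith [hq'.2]
  rw [hd]
  exact le_antisymm ((measure_union_le _ _).trans (by rw [hz, add_zero])) (measure_mono subset_union_left)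

lemma pz_gstep {β : ℕ → ℝ} (hβ : ValidBeta β) {Φ : ℝ → ℝ → ℝ} {m t s : ℝ} (hs : 0 ≤ s) (hst : s ≤ t)
    (ht : t ≤ 1) (hΦ : pzLip (Φ t)) (x : ℝ) :
    gStep β Φ m t s x = pzT m (xiD β t - xiD β s) (Φ t) x := by
  have hh := sub_nonneg.2 (pz_xi_mono hβ hs hst ht)
  have hc := hΦ.cont
  unfold gStep pzT
  split_ifs
  · rw [pz_scale hh (by fun_prop)]
  · rw [pz_scale hh (by fun_prop)]

lemma pz_card {S : Finset ℝ} {s q : ℝ} (hq : q ∈ S) (hsq : s < q) :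
    (S.filter (fun z => q < z)).card < (S.filter (fun z => s < z)).card := by
  apply Finset.card_lt_card
  rw [Finset.ssubset_iff_of_subset]
  · exact ⟨q, by simp [hq, hsq], by simp⟩
  · intro z hz
    simp only [Finset.mem_filter] at hz ⊢
    exact ⟨hz.1, hsq.trans hz.2⟩

lemma pz_atomic_cls {β : ℕ → ℝ} (hβ : ValidBeta β) {ν : Measure ℝ} (hν : MemM ν) {S : Finset ℝ}
    (hS : ν ((S : Set ℝ))ᶜ = 0) {u : ℝ → ℝ → ℝ} (hu : IsAtomicSol β ν u) :
    ∀ (n : ℕ) (s : ℝ), s ∈ Icc (0 : ℝ) 1 → (S.filter (fun z => s < z)).card < n → pzC (u s) := by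
  have h1 : pzC (u 1) := by
    have : u 1 = fun x => Real.log (Real.cosh x) := funext hu.1
    rw [this]; exact pz_logcosh
  intro n
  induction n with
  | zero => intro s _ h; omega
  | succ n ih =>
    intro s hs hcard
    rcases hs.2.eq_or_lt with h | h
    · rw [h]; exact h1
    · have hq := pz_next_gt hS h
      have hq1 := pz_next_le (ν := ν) s
      have hc : pzC (u (nextPt ν s)) := by
        rcases pz_next_mem hS s with hm | hm
        · have hqS := pz_next_finite hS s _ hm
          exact ih _ ⟨hs.1.trans hq.le, hq1⟩ (by have := pz_card hqS hq; omega)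
        · rw [mem_singleton_iff] at hm; rw [hm]; exact h1
      have : u s = pzT (distF ν s) (xiD β (nextPt ν s) - xiD β s) (u (nextPt ν s)) := by
        funext x
        rw [hu.2 s ⟨hs.1, h⟩ x, pz_gstep hβ hs.1 hq.le hq1 hc.lip]
      rw [this]
      exact pz_T_cls hc (pz_distF_nonneg _ _) (pz_distF_le hν _) _

lemma pz_T_zero {f : ℝ → ℝ} (hf : pzC f) {m : ℝ} (hm : 0 ≤ m) (hm1 : m ≤ 1) (x : ℝ) :
    pzT m 0 f x = f x := by
  have h1 := pz_T_lower hf hm 0 x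
  have h2 := pz_T_upper hf hm hm1 le_rfl x
  linarith

lemma pz_atomic_step {β : ℕ → ℝ} (hβ : ValidBeta β) {ν : Measure ℝ} (hν : MemM ν) {S : Finset ℝ}
    (hS : ν ((S : Set ℝ))ᶜ = 0) {u : ℝ → ℝ → ℝ} (hu : IsAtomicSol β ν u) {s : ℝ} (hs : 0 ≤ s)
    (h1 : s < 1) : u s = pzT (distF ν s) (xiD β (nextPt ν s) - xiD β s) (u (nextPt ν s)) := by
  funext x
  have hq := pz_next_gt hS h1
  have hq1 := pz_next_le (ν := ν) s
  rw [hu.2 s ⟨hs, h1⟩ x, pz_gstep hβ hs hq.le hq1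
    (pz_atomic_cls hβ hν hS hu _ _ ⟨hs.trans hq.le, hq1⟩ (Nat.lt_succ_self _)).lip]

lemma pz_atomic_comp {β : ℕ → ℝ} (hβ : ValidBeta β) {ν : Measure ℝ} (hν : MemM ν) {S : Finset ℝ}
    (hS : ν ((S : Set ℝ))ᶜ = 0) {u : ℝ → ℝ → ℝ} (hu : IsAtomicSol β ν u) {m M b : ℝ}
    (hm : 0 ≤ m) (hm1 : m ≤ 1) (hM : 0 ≤ M) (hM1 : M ≤ 1) (hb : b ≤ 1) :
    ∀ (n : ℕ) (s : ℝ), 0 ≤ s → s ≤ b → (S.filter (fun z => s < z)).card < n →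
      (∀ v, s ≤ v → v < b → m ≤ distF ν v ∧ distF ν v ≤ M) → ∀ x,
      pzT m (xiD β b - xiD β s) (u b) x ≤ u s x ∧ u s x ≤ pzT M (xiD β b - xiD β s) (u b) x := by
  have cls : ∀ r, 0 ≤ r → r ≤ 1 → pzC (u r) := fun r h0 h1 =>
    pz_atomic_cls hβ hν hS hu _ r ⟨h0, h1⟩ (Nat.lt_succ_self _)
  intro n
  induction n with
  | zero => intro s _ _ h; omega
  | succ n ih =>
    intro s hs hsb hcard hα x
    have hcb := cls b (hs.trans hsb) hb
    rcases hsb.eq_or_lt with h | h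
    · subst h
      rw [sub_self, pz_T_zero hcb hm hm1, pz_T_zero hcb hM hM1]
      exact ⟨le_rfl, le_rfl⟩
    · have hs1 : s < 1 := h.trans_le hb
      have hq := pz_next_gt hS hs1
      have hq1 := pz_next_le (ν := ν) s
      have hstep := pz_atomic_step hβ hν hS hu hs hs1
      have hαs := hα s le_rfl h
      have hα0 := pz_distF_nonneg ν s
      set q := nextPt ν s with hqdef
      have hq0 : 0 ≤ q := hs.trans hq.le
      have hcq := cls q hq0 hq1
      have d1 := sub_nonneg.2 (pz_xi_mono hβ hs hq.le hq1)
      rcases le_or_gt q b with hqb | hqb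
      · have IH : ∀ y, pzT m (xiD β b - xiD β q) (u b) y ≤ u q y ∧
            u q y ≤ pzT M (xiD β b - xiD β q) (u b) y := by
          rcases pz_next_mem hS s with hmem | hmem
          · have hqS := pz_next_finite hS s _ hmem
            refine ih q hq0 hqb (lt_of_lt_of_le (pz_card hqS hq) (Nat.lt_succ_iff.1 hcard)) fun v hv1 hv2 =>
              hα v (hq.le.trans hv1) hv2
          · rw [mem_singleton_iff] at hmem
            have : q = b := le_antisymm hqb (by rw [hqdef, hmem]; exact hb)
            intro y
            rw [this, sub_self, pz_T_zero hcb hm hm1, pz_T_zero hcb hM hM1]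
            exact ⟨le_rfl, le_rfl⟩
        have d2 := sub_nonneg.2 (pz_xi_mono hβ hq0 hqb hb)
        have e : xiD β b - xiD β s = (xiD β q - xiD β s) + (xiD β b - xiD β q) := by ring
        rw [e, ← pz_semigroup hcb.lip m d1 d2, ← pz_semigroup hcb.lip M d1 d2, hstep]
        constructor
        · refine le_trans ?_ (pz_T_mono_m hcq.lip hm hαs.1 _ x)
          have := pz_comp (pz_T_lip hcb.lip hm (xiD β b - xiD β q)) hcq.lip hm (xiD β q - xiD β s) x x 0
            (fun w => by linarith [(IH (x + w)).1])
          linarith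
        · refine le_trans (pz_T_mono_m hcq.lip hα0 hαs.2 _ x) ?_
          have := pz_comp hcq.lip (pz_T_lip hcb.lip hM (xiD β b - xiD β q)) hM (xiD β q - xiD β s) x x 0
            (fun w => by linarith [(IH (x + w)).2])
          linarith
      · have e1 : nextPt ν b = q := pz_next_eq h.le hqb
        have e2 : distF ν b = distF ν s := pz_dist_eq hν hS hs h.le hqb
        have hstepb := pz_atomic_step hβ hν hS hu (hs.trans hsb) (hqb.trans_le hq1)
        rw [e1, e2] at hstepb
        have d2 := sub_nonneg.2 (pz_xi_mono hβ (hs.trans hsb) hqb.le hq1)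
        have d3 := sub_nonneg.2 (pz_xi_mono hβ hs hsb hb)
        have e : u s x = pzT (distF ν s) (xiD β b - xiD β s) (u b) x := by
          rw [hstepb, pz_semigroup hcq.lip _ d3 d2, hstep]
          congr 1; ring
        rw [e]
        exact ⟨pz_T_mono_m hcb.lip hm hαs.1 _ x, pz_T_mono_m hcb.lip hα0 hαs.2 _ x⟩



/-! ### Discretising a general measure -/

def pzc (n : ℕ) (a b x : ℝ) : ℝ :=
  min ((⌈(n : ℝ) * x⌉₊ : ℝ) / n) (if x ≤ a then a else if x ≤ b then b else 1)

lemma pzc_meas (n : ℕ) (a b : ℝ) : Measurable (pzc n a b) := by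
  unfold pzc
  refine Measurable.min ?_ ?_
  · exact ((measurable_from_nat (f := fun k : ℕ => (k : ℝ))).comp
      (Nat.measurable_ceil.comp (measurable_id.const_mul _))).div_const _
  · exact Measurable.ite measurableSet_Iic measurable_const
      (Measurable.ite measurableSet_Iic measurable_const measurable_const)

lemma pzc_ge {n : ℕ} (hn : 0 < n) (a b : ℝ) {x : ℝ} (hx1 : x ≤ 1) : x ≤ pzc n a b x := by
  have hn' : (0 : ℝ) < n := by exact_mod_cast hn
  refine le_min ?_ ?_
  · rw [le_div_iff₀ hn', mul_comm]; exact Nat.le_ceil _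
  · split_ifs <;> assumption

lemma pzc_le {n : ℕ} (hn : 0 < n) (a b : ℝ) {x : ℝ} (hx0 : 0 ≤ x) : pzc n a b x ≤ x + 1 / n := by
  have hn' : (0 : ℝ) < n := by exact_mod_cast hn
  refine (min_le_left _ _).trans ?_
  rw [div_le_iff₀ hn', add_mul, one_div, inv_mul_cancel₀ hn'.ne', mul_comm x]
  exact (Nat.ceil_lt_add_one (by positivity)).le

lemma pzc_le_one (n : ℕ) {a b : ℝ} (ha : a ≤ 1) (hb : b ≤ 1) (x : ℝ) : pzc n a b x ≤ 1 := by
  refine (min_le_right _ _).trans ?_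
  split_ifs <;> first | assumption | exact le_rfl

lemma pzc_le_a (n : ℕ) {a b x : ℝ} (hx : x ≤ a) : pzc n a b x ≤ a := by
  refine (min_le_right _ _).trans ?_
  rw [if_pos hx]

lemma pzc_mem {n : ℕ} {a b x : ℝ} (hx : x ∈ Icc (0 : ℝ) 1) :
    pzc n a b x ∈ ((Finset.range (n + 1)).image (fun k : ℕ => (k : ℝ) / n) ∪ {a, b, 1} : Finset ℝ) := by
  rw [Finset.mem_union]
  unfold pzc
  rcases min_choice ((⌈(n : ℝ) * x⌉₊ : ℝ) / n) (if x ≤ a then a else if x ≤ b then b else 1) with h | h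
  · left
    rw [h, Finset.mem_image]
    refine ⟨⌈(n : ℝ) * x⌉₊, ?_, rfl⟩
    rw [Finset.mem_range, Nat.lt_succ_iff, Nat.ceil_le]
    have : (0 : ℝ) ≤ n := Nat.cast_nonneg n
    nlinarith [hx.2]
  · right
    rw [h]
    split_ifs <;> simp

lemma pz_ae_mem {μ : Measure ℝ} (hμ : MemM μ) : ∀ᵐ x ∂μ, x ∈ Icc (0 : ℝ) 1 := by
  rw [ae_iff]; exact hμ.2

def pzN (μ : Measure ℝ) (n : ℕ) (a b : ℝ) : Measure ℝ := μ.map (pzc n a b)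

section
variable {μ : Measure ℝ} (hμ : MemM μ) {n : ℕ} (hn : 0 < n) {a b : ℝ}
include hμ hn

lemma pzN_mem (ha : a ≤ 1) (hb : b ≤ 1) : MemM (pzN μ n a b) := by
  have := hμ.1
  refine ⟨Measure.isProbabilityMeasure_map (pzc_meas n a b).aemeasurable, ?_⟩
  rw [pzN, Measure.map_apply (pzc_meas n a b) measurableSet_Icc.compl]
  refine measure_mono_null ?_ hμ.2
  intro x hx hx'
  exact hx ⟨hx'.1.trans (pzc_ge hn a b hx'.2), pzc_le_one n ha hb x⟩

lemma pzN_dist (v : ℝ) : distF (pzN μ n a b) v = (μ (pzc n a b ⁻¹' Icc 0 v)).toReal := by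
  unfold distF pzN
  rw [Measure.map_apply (pzc_meas n a b) measurableSet_Icc]

lemma pzN_dist_le (v : ℝ) : distF (pzN μ n a b) v ≤ distF μ v := by
  have := hμ.1
  rw [pzN_dist hμ hn]
  refine ENNReal.toReal_mono (measure_ne_top _ _) (measure_mono_ae ?_)
  filter_upwards [pz_ae_mem hμ] with x hx h
  exact ⟨hx.1, (pzc_ge hn a b hx.2).trans h.2⟩

lemma pzN_dist_ge {v : ℝ} (hv : v ≤ 1) : distF μ (v - 1 / n) ≤ distF (pzN μ n a b) v := by
  have := hμ.1
  rw [pzN_dist hμ hn]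
  refine ENNReal.toReal_mono (measure_ne_top _ _) (measure_mono ?_)
  intro x hx
  have : (0 : ℝ) ≤ 1 / n := by positivity
  exact ⟨hx.1.trans (pzc_ge hn a b (by linarith [hx.2])), (pzc_le hn a b hx.1).trans (by linarith [hx.2])⟩

lemma pzN_dist_ge' (ha : a ≤ 1) {v : ℝ} (hv : a ≤ v) : distF μ a ≤ distF (pzN μ n a b) v := by
  have := hμ.1
  rw [pzN_dist hμ hn]
  refine ENNReal.toReal_mono (measure_ne_top _ _) (measure_mono ?_)
  intro x hx
  exact ⟨hx.1.trans (pzc_ge hn a b (hx.2.trans ha)), (pzc_le_a n hx.2).trans hv⟩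

lemma pzN_fin : ((pzN μ n a b) (((Finset.range (n + 1)).image (fun k : ℕ => (k : ℝ) / n) ∪ {a, b, 1} :
    Finset ℝ) : Set ℝ)ᶜ) = 0 := by
  rw [pzN, Measure.map_apply (pzc_meas n a b) (Finset.measurableSet _).compl]
  refine measure_mono_null ?_ hμ.2
  intro x hx hx'
  exact hx (pzc_mem hx')

lemma pzN_dM (ha : a ≤ 1) (hb : b ≤ 1) : dM μ (pzN μ n a b) ≤ 1 / n := by
  have hm := pz_distF_mono hμ
  have hm2 := pz_distF_mono (pzN_mem (n := n) hμ hn ha hb)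
  have hi : ∀ c d : ℝ, IntervalIntegrable (distF μ) volume c d := fun c d => hm.intervalIntegrable
  have hms : Monotone (fun v => distF μ (v - 1 / n)) := fun x y h => hm (by linarith)
  have hi2 : IntervalIntegrable (fun v => distF μ (v - 1 / n)) volume 0 1 := hms.intervalIntegrable
  have hn' : (0 : ℝ) ≤ 1 / n := by positivity
  have e1 : dM μ (pzN μ n a b) ≤ ∫ v in (0 : ℝ)..1, (distF μ v - distF μ (v - 1 / n)) := by
    refine intervalIntegral.integral_mono_on zero_le_one
      ((hi 0 1).sub hm2.intervalIntegrable).abs ((hi 0 1).sub hi2) fun v hv => ?_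
    rw [abs_of_nonneg (sub_nonneg.2 (pzN_dist_le hμ hn v))]
    linarith [pzN_dist_ge (a := a) (b := b) hμ hn hv.2]
  rw [intervalIntegral.integral_sub (hi 0 1) hi2, intervalIntegral.integral_comp_sub_right] at e1
  have e2 := intervalIntegral.integral_interval_sub_interval_comm (hi 0 1) (hi (0 - 1 / n) (1 - 1 / n)) (hi 0 (0 - 1 / n))
  have e3 : 0 ≤ ∫ v in (0 - 1 / n : ℝ)..0, distF μ v :=
    intervalIntegral.integral_nonneg (by linarith) fun v _ => pz_distF_nonneg μ v
  have e4 : ∫ v in (1 - 1 / n : ℝ)..1, distF μ v ≤ 1 / n := by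
    have := intervalIntegral.integral_mono_on (a := (1 - 1 / n : ℝ)) (b := 1) (f := distF μ) (g := fun _ => (1 : ℝ))
      (by linarith) (hi _ _) (by simp) fun v _ => pz_distF_le hμ v
    simpa using this
  rw [intervalIntegral.integral_symm (0 - 1 / n : ℝ) 0, intervalIntegral.integral_symm (1 - 1 / n : ℝ) 1] at e2
  linarith
end

section
variable {β : ℕ → ℝ} (hβ : ValidBeta β) {Φ : Measure ℝ → ℝ → ℝ → ℝ} (hΦ : IsParisiFamily β Φ)
  {μ : Measure ℝ} (hμ : MemM μ)
include hβ hΦ hμ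

lemma pz_approx {a b : ℝ} (ha : 0 ≤ a) (hab : a ≤ b) (hb : b ≤ 1) {ε : ℝ} (hε : 0 < ε) :
    ∃ u : ℝ → ℝ → ℝ, (∀ r ∈ Icc (0 : ℝ) 1, pzC (u r)) ∧
      (∀ r ∈ Icc (0 : ℝ) 1, ∀ x, |Φ μ r x - u r x| < ε) ∧
      ∀ x, pzT (distF μ a) (xiD β b - xiD β a) (u b) x ≤ u a x ∧
        u a x ≤ pzT (distF μ b) (xiD β b - xiD β a) (u b) x := by
  obtain ⟨δ, hδ, H⟩ := hΦ.2 μ hμ ε hε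
  obtain ⟨n, hn⟩ := exists_nat_one_div_lt hδ
  have hn0 : 0 < n + 1 := Nat.succ_pos n
  have hν := pzN_mem (n := n + 1) hμ hn0 (hab.trans hb) hb
  have hS := pzN_fin (a := a) (b := b) hμ hn0
  have hsol := hΦ.1 _ hν ⟨_, hS⟩
  have hd : dM μ (pzN μ (n + 1) a b) < δ := by
    refine (pzN_dM hμ hn0 (hab.trans hb) hb).trans_lt ?_
    push_cast; exact hn
  refine ⟨Φ (pzN μ (n + 1) a b), fun r hr => pz_atomic_cls hβ hν hS hsol _ r hr (Nat.lt_succ_self _),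
    H _ hν hd, ?_⟩
  refine pz_atomic_comp hβ hν hS hsol (pz_distF_nonneg _ _) (pz_distF_le hμ _) (pz_distF_nonneg _ _)
    (pz_distF_le hμ _) hb _ a ha hab (Nat.lt_succ_self _) fun v hv1 hv2 => ⟨?_, ?_⟩
  · exact pzN_dist_ge' hμ hn0 (hab.trans hb) hv1
  · exact (pzN_dist_le hμ hn0 v).trans (pz_distF_mono hμ hv2.le)

lemma pz_cls {r : ℝ} (hr : r ∈ Icc (0 : ℝ) 1) : pzC (Φ μ r) := by
  choose u hu1 hu2 hu3 using fun n : ℕ => pz_approx hβ hΦ hμ hr.1 le_rfl hr.2 (ε := 1 / ((n : ℝ) + 1)) (by positivity)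
  refine pzC.lim (F := fun n => u n r) (fun n => hu1 n r hr) fun x => ?_
  rw [tendsto_iff_dist_tendsto_zero]
  refine squeeze_zero (fun _ => dist_nonneg) (fun n => ?_) tendsto_one_div_add_atTop_nhds_zero_nat
  rw [dist_comm, Real.dist_eq]
  exact (hu2 n r hr x).le

lemma pz_step {a b : ℝ} (ha : 0 ≤ a) (hab : a ≤ b) (hb : b ≤ 1) (x : ℝ) :
    pzT (distF μ a) (xiD β b - xiD β a) (Φ μ b) x ≤ Φ μ a x ∧
        Φ μ a x ≤ pzT (distF μ b) (xiD β b - xiD β a) (Φ μ b) x := by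
  have hcb : pzC (Φ μ b) := pz_cls hβ hΦ hμ ⟨ha.trans hab, hb⟩
  constructor
  all_goals
    refine le_of_forall_pos_le_add fun ε hε => ?_
    obtain ⟨u, hu1, hu2, hu3⟩ := pz_approx hβ hΦ hμ ha hab hb (half_pos hε)
    have hub := hu1 b ⟨ha.trans hab, hb⟩
    have ea := abs_lt.1 (hu2 a ⟨ha, hab.trans hb⟩ x)
  · have := pz_comp hcb.lip hub.lip (pz_distF_nonneg μ a) (xiD β b - xiD β a) x x (ε / 2)
      fun w => by linarith [(abs_lt.1 (hu2 b ⟨ha.trans hab, hb⟩ (x + w))).2]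
    linarith [(hu3 x).1]
  · have := pz_comp hub.lip hcb.lip (pz_distF_nonneg μ b) (xiD β b - xiD β a) x x (ε / 2)
      fun w => by linarith [(abs_lt.1 (hu2 b ⟨ha.trans hab, hb⟩ (x + w))).1]
    linarith [(hu3 x).2]

lemma pz_time {a b : ℝ} (ha : 0 ≤ a) (hab : a ≤ b) (hb : b ≤ 1) (x : ℝ) :
    Φ μ a x - Φ μ b x ∈ Icc 0 ((xiD β b - xiD β a) / 2) := by
  have hcb : pzC (Φ μ b) := pz_cls hβ hΦ hμ ⟨ha.trans hab, hb⟩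
  have h := pz_step hβ hΦ hμ ha hab hb x
  have h1 := pz_T_lower hcb (pz_distF_nonneg μ a) (xiD β b - xiD β a) x
  have h2 := pz_T_upper hcb (pz_distF_nonneg μ b) (pz_distF_le hμ b)
    (sub_nonneg.2 (pz_xi_mono hβ ha hab hb)) x
  constructor <;> linarith [h.1, h.2]

lemma pz_deriv_time {a b : ℝ} (ha : 0 ≤ a) (hab : a ≤ b) (hb : b ≤ 1) (x : ℝ) :
    |deriv (Φ μ a) x - deriv (Φ μ b) x| ≤ 3 / 2 * √(xiD β b - xiD β a) := by
  have hca : pzC (Φ μ a) := pz_cls hβ hΦ hμ ⟨ha, hab.trans hb⟩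
  have hcb : pzC (Φ μ b) := pz_cls hβ hΦ hμ ⟨ha.trans hab, hb⟩
  have hh := sub_nonneg.2 (pz_xi_mono hβ ha hab hb)
  have ht := pz_time hβ hΦ hμ ha hab hb
  set h := xiD β b - xiD β a
  rcases hh.eq_or_lt with h0 | h0
  · have : Φ μ a = Φ μ b := by
      funext z
      have := ht z
      rw [← h0] at this
      have h1 := this.1
      have h2 := this.2
      norm_num at h2
      linarith
    rw [this, sub_self, abs_zero]; positivity
  · have := pz_deriv_close hca hcb ht (Real.sqrt_pos.2 h0) (x := x)
    refine this.trans (le_of_eq ?_)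
    have : h / 2 / √h = √h / 2 := by
      rw [div_right_comm, Real.div_sqrt]
    rw [this]; ring

lemma pz_onestep {a b : ℝ} (ha : 0 ≤ a) (hab : a ≤ b) (hb : b ≤ 1) (hh : xiD β b - xiD β a ≤ 1) (y : ℝ) :
    |Φ μ a y - (∫ w, Φ μ b (y + w) ∂pzG (xiD β b - xiD β a))
        - distF μ a / 2 * (xiD β b - xiD β a) * deriv (Φ μ b) y ^ 2|
      ≤ pzK * ((xiD β b - xiD β a) * √(xiD β b - xiD β a))
        + (xiD β b - xiD β a) / 2 * (distF μ b - distF μ a) := by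
  have hcb : pzC (Φ μ b) := pz_cls hβ hΦ hμ ⟨ha.trans hab, hb⟩
  have h0 := sub_nonneg.2 (pz_xi_mono hβ ha hab hb)
  have hst := pz_step hβ hΦ hμ ha hab hb y
  have h1 := abs_le.1 (pz_expand hcb (pz_distF_nonneg μ a) (pz_distF_le hμ a) h0 hh y)
  have h2 := abs_le.1 (pz_expand hcb (pz_distF_nonneg μ b) (pz_distF_le hμ b) h0 hh y)
  have hd := abs_le.1 (hcb.deriv_le (x := y))
  have hsq : deriv (Φ μ b) y ^ 2 ≤ 1 := by nlinarith
  have hα := sub_nonneg.2 (pz_distF_mono hμ hab)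
  have key : (xiD β b - xiD β a) / 2 * (distF μ b - distF μ a) * deriv (Φ μ b) y ^ 2 ≤
      (xiD β b - xiD β a) / 2 * (distF μ b - distF μ a) := by
    have : 0 ≤ (xiD β b - xiD β a) / 2 * (distF μ b - distF μ a) := by positivity
    nlinarith
  have key0 : 0 ≤ (xiD β b - xiD β a) / 2 * (distF μ b - distF μ a) := by positivity
  rw [abs_le]
  constructor <;> nlinarith [hst.1, hst.2]

end



/-! ### Freezing lemma -/

lemma pz_freeze {Ω : Type*} {m : MeasurableSpace Ω} [mΩ : MeasurableSpace Ω] (P : Measure Ω)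
    [IsProbabilityMeasure P] (hm : m ≤ mΩ) {Y G : Ω → ℝ} (hY : Measurable[m] Y) (hG : Measurable G)
    {h : ℝ} (hlaw : P.map G = pzG h)
    (hind : Indep (MeasurableSpace.comap G inferInstance) m P)
    {F : ℝ → ℝ} (hF : Continuous F) {C : ℝ} (hC : ∀ z, |F z| ≤ C) {A : Set Ω} (hA : MeasurableSet[m] A) :
    ∫ ω in A, F (Y ω + G ω) ∂P = ∫ ω in A, (∫ w, F (Y ω + w) ∂pzG h) ∂P := by
  classical
  let J : Ω → ℝ × ℝ := fun ω => (Y ω, A.indicator (fun _ => (1 : ℝ)) ω)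
  have hJm : Measurable[m] J := hY.prodMk (measurable_const.indicator hA)
  have hJ : Measurable J := hJm.mono hm le_rfl
  have hindJ : IndepFun J G P := by
    rw [IndepFun_iff_Indep]
    refine indep_of_indep_of_le_left hind.symm ?_
    exact hJm.comap_le
  have hmap := (indepFun_iff_map_prod_eq_prod_map_map hJ.aemeasurable hG.aemeasurable).1 hindJ
  have hP1 : IsProbabilityMeasure (P.map J) := Measure.isProbabilityMeasure_map hJ.aemeasurable
  let H : (ℝ × ℝ) × ℝ → ℝ := fun q => (min 1 (max 0 q.1.2)) * F (q.1.1 + q.2)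
  have hHc : Continuous H := by fun_prop
  have hHb : ∀ q, ‖H q‖ ≤ C := by
    intro q
    rw [Real.norm_eq_abs, abs_mul]
    have h1 : |min (1 : ℝ) (max 0 q.1.2)| ≤ 1 := by
      rw [abs_le]; constructor
      · have : (0 : ℝ) ≤ min 1 (max 0 q.1.2) := by positivity
        linarith
      · exact min_le_left _ _
    have h2 := hC (q.1.1 + q.2)
    have h3 := abs_nonneg (F (q.1.1 + q.2))
    have h4 := abs_nonneg (min (1 : ℝ) (max 0 q.1.2))
    nlinarith
  have hind1 : ∀ (g : Ω → ℝ) ω, (min 1 (max 0 (J ω).2)) * g ω = A.indicator g ω := by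
    intro g ω
    by_cases hω : ω ∈ A <;> simp [J, hω]
  have hA' : MeasurableSet A := hm _ hA
  have l : ∫ ω in A, F (Y ω + G ω) ∂P = ∫ q, H q ∂(P.map fun ω => (J ω, G ω)) := by
    rw [integral_map (hJ.prodMk hG).aemeasurable hHc.aestronglyMeasurable, ← integral_indicator hA']
    refine integral_congr_ae (Eventually.of_forall fun ω => ?_)
    exact (hind1 (fun ω => F (Y ω + G ω)) ω).symm
  rw [l, hmap, hlaw, integral_prod _ (Integrable.of_bound hHc.aestronglyMeasurable C (Eventually.of_forall hHb)),
    integral_map hJ.aemeasurable]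
  · rw [← integral_indicator hA']
    refine integral_congr_ae (Eventually.of_forall fun ω => ?_)
    simp only [H]
    rw [integral_const_mul]
    exact hind1 (fun ω => ∫ w, F (Y ω + w) ∂pzG h) ω
  · have := (hHc.stronglyMeasurable.integral_prod_right' (ν := pzG h))
    exact this.aestronglyMeasurable

/-! ### Pathwise facts -/

section
variable {β : ℕ → ℝ} (hβ : ValidBeta β) {Φ : Measure ℝ → ℝ → ℝ → ℝ} (hΦ : IsParisiFamily β Φ)
  {μ : Measure ℝ} (hμ : MemM μ) {s t : ℝ} (hs : 0 ≤ s) (ht : t ≤ 1)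
include hβ hΦ hμ hs ht

lemma pz_V_cont {X : ℝ → ℝ} (hX : ContinuousOn X (Icc s t)) :
    ContinuousOn (fun v => deriv (Φ μ v) (X v)) (Icc s t) := by
  intro r hr
  have hxi : ContinuousOn (xiD β) (Icc s t) := fun v hv =>
    (pz_xi_deriv hβ (pz_abs_lt ⟨hs.trans hv.1, hv.2.trans ht⟩)).continuousAt.continuousWithinAt
  have hb : ∀ v ∈ Icc s t, |deriv (Φ μ v) (X v) - deriv (Φ μ r) (X r)| ≤
      3 / 2 * √|xiD β v - xiD β r| + 2 * |X v - X r| := by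
    intro v hv
    have h1 : |deriv (Φ μ v) (X v) - deriv (Φ μ r) (X v)| ≤ 3 / 2 * √|xiD β v - xiD β r| := by
      rcases le_total v r with h | h
      · refine (pz_deriv_time hβ hΦ hμ (hs.trans hv.1) h (hr.2.trans ht) _).trans ?_
        rw [abs_sub_comm]
        gcongr
        exact le_abs_self _
      · rw [abs_sub_comm]
        refine (pz_deriv_time hβ hΦ hμ (hs.trans hr.1) h (hv.2.trans ht) _).trans ?_
        gcongr
        exact le_abs_self _
    have h2 := (pz_cls hβ hΦ hμ ⟨hs.trans hr.1, hr.2.trans ht⟩).deriv_lip (X v) (X r)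
    exact (abs_sub_le _ _ _).trans (add_le_add h1 h2)
  have hc : ContinuousWithinAt (fun v => 3 / 2 * √|xiD β v - xiD β r| + 2 * |X v - X r|) (Icc s t) r :=
    ((((hxi r hr).sub continuousWithinAt_const).abs.sqrt).const_mul _).add
      ((((hX r hr).sub continuousWithinAt_const).abs).const_mul _)
  have h0 : Tendsto (fun v => 3 / 2 * √|xiD β v - xiD β r| + 2 * |X v - X r|) (nhdsWithin r (Icc s t)) (nhds 0) := by
    have := hc.tendsto
    simpa using this
  refine tendsto_iff_dist_tendsto_zero.2 (squeeze_zero' (Eventually.of_forall fun _ => dist_nonneg) ?_ h0)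
  filter_upwards [self_mem_nhdsWithin] with v hv
  exact hb v hv

lemma pz_int_ok {X : ℝ → ℝ} (hX : ContinuousOn X (Icc s t)) {a b : ℝ} (ha : s ≤ a) (hab : a ≤ b) (hb : b ≤ t) :
    IntervalIntegrable (fun v => distF μ v * zetaFn β v * deriv (Φ μ v) (X v)) volume a b := by
  have hsub : uIcc a b ⊆ Icc s t := by rw [uIcc_of_le hab]; exact Icc_subset_Icc ha hb
  refine IntervalIntegrable.mul_continuousOn (IntervalIntegrable.mul_continuousOn
    (pz_distF_mono hμ).intervalIntegrable ?_) ((pz_V_cont hβ hΦ hμ hs ht hX).mono hsub)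
  exact (pz_zeta_cont hβ).mono (hsub.trans (Icc_subset_Icc hs ht))

lemma pz_D_bound {X : ℝ → ℝ} (hX : ContinuousOn X (Icc s t)) {a b : ℝ} (ha : s ≤ a) (hab : a ≤ b) (hb : b ≤ t)
    {u ε : ℝ} (hu : ∀ v ∈ Icc a b, |deriv (Φ μ v) (X v) - u| ≤ ε) :
    |(∫ v in a..b, distF μ v * zetaFn β v * deriv (Φ μ v) (X v)) - distF μ a * (xiD β b - xiD β a) * u|
      ≤ (xiD β b - xiD β a) * (distF μ b - distF μ a) + (xiD β b - xiD β a) * ε := by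
  have hz := pz_zeta_int hβ (hs.trans ha) hab (hb.trans ht)
  have hzi := pz_zeta_ii hβ (hs.trans ha) hab (hb.trans ht)
  have e1 : distF μ a * (xiD β b - xiD β a) * u = ∫ v in a..b, distF μ a * u * zetaFn β v := by
    rw [intervalIntegral.integral_const_mul, hz]; ring
  have e2 : (xiD β b - xiD β a) * (distF μ b - distF μ a) + (xiD β b - xiD β a) * ε =
      ∫ v in a..b, (distF μ b - distF μ a + ε) * zetaFn β v := by
    rw [intervalIntegral.integral_const_mul, hz]; ring
  rw [e1, e2, ← intervalIntegral.integral_sub (pz_int_ok hβ hΦ hμ hs ht hX ha hab hb) (hzi.const_mul _),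
    ← Real.norm_eq_abs]
  refine intervalIntegral.norm_integral_le_of_norm_le hab ?_ (hzi.const_mul _)
  refine Eventually.of_forall fun v hv => ?_
  have hv' : v ∈ Icc a b := ⟨hv.1.le, hv.2⟩
  have hζ : 0 ≤ zetaFn β v := pz_zeta_nonneg (hs.trans (ha.trans hv'.1))
  have hV := (pz_cls hβ hΦ hμ ⟨hs.trans (ha.trans hv'.1), (hv'.2.trans hb).trans ht⟩).deriv_le (X v)
  have hα1 := pz_distF_mono hμ hv'.1
  have hα2 := pz_distF_mono hμ hv'.2
  have hα3 := pz_distF_nonneg μ a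
  have hα4 := pz_distF_le hμ a
  have hε := hu v hv'
  rw [Real.norm_eq_abs, show distF μ v * zetaFn β v * deriv (Φ μ v) (X v) - distF μ a * u * zetaFn β v
    = ((distF μ v - distF μ a) * deriv (Φ μ v) (X v) + distF μ a * (deriv (Φ μ v) (X v) - u)) * zetaFn β v by ring,
    abs_mul, abs_of_nonneg hζ]
  refine mul_le_mul_of_nonneg_right ?_ hζ
  refine (abs_add_le _ _).trans ?_
  rw [abs_mul, abs_mul, abs_of_nonneg hα3, abs_of_nonneg (sub_nonneg.2 hα1)]
  have := abs_nonneg (deriv (Φ μ v) (X v) - u)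
  nlinarith

lemma pz_D_le {X : ℝ → ℝ} (hX : ContinuousOn X (Icc s t)) {a b : ℝ} (ha : s ≤ a) (hab : a ≤ b) (hb : b ≤ t) :
    |(∫ v in a..b, distF μ v * zetaFn β v * deriv (Φ μ v) (X v))| ≤ xiD β b - xiD β a := by
  rw [← pz_zeta_int hβ (hs.trans ha) hab (hb.trans ht), ← Real.norm_eq_abs]
  refine intervalIntegral.norm_integral_le_of_norm_le hab ?_ (pz_zeta_ii hβ (hs.trans ha) hab (hb.trans ht))
  refine Eventually.of_forall fun v hv => ?_
  have hv' : v ∈ Icc a b := ⟨hv.1.le, hv.2⟩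
  have hζ : 0 ≤ zetaFn β v := pz_zeta_nonneg (hs.trans (ha.trans hv'.1))
  have hV := (pz_cls hβ hΦ hμ ⟨hs.trans (ha.trans hv'.1), (hv'.2.trans hb).trans ht⟩).deriv_le (X v)
  have hα3 := pz_distF_nonneg μ v
  have hα4 := pz_distF_le hμ v
  rw [Real.norm_eq_abs, abs_mul, abs_mul, abs_of_nonneg hζ, abs_of_nonneg hα3]
  have h1 := abs_nonneg (deriv (Φ μ v) (X v))
  have h2 : distF μ v * |deriv (Φ μ v) (X v)| ≤ 1 := by nlinarith
  nlinarith

/-- pointwise one-step estimate -/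
lemma pz_pointwise {a b : ℝ} (ha : 0 ≤ a) (hab : a ≤ b) (hb : b ≤ 1) (hh : xiD β b - xiD β a ≤ 1)
    (δ Y G D : ℝ) (hD : |D| ≤ xiD β b - xiD β a) :
    |(Φ μ b (Y + G + D + δ) - Φ μ b (Y + G + D)) - (Φ μ a (Y + δ) - Φ μ a Y)
      - ((Φ μ b (Y + G + δ) - Φ μ b (Y + G)) -
          ((∫ w, Φ μ b (Y + δ + w) ∂pzG (xiD β b - xiD β a)) - ∫ w, Φ μ b (Y + w) ∂pzG (xiD β b - xiD β a)))|
    ≤ 2 * |δ| * |D - distF μ a * (xiD β b - xiD β a) * deriv (Φ μ b) Y|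
      + 2 * (xiD β b - xiD β a) * δ ^ 2
      + 2 * √(xiD β b - xiD β a) * (G ^ 2 + (xiD β b - xiD β a))
      + (1 + 2 * pzK) * ((xiD β b - xiD β a) * √(xiD β b - xiD β a))
      + (xiD β b - xiD β a) * (distF μ b - distF μ a) := by
  have o1 := pz_onestep hβ hΦ hμ ha hab hb hh (Y + δ)
  have o2 := pz_onestep hβ hΦ hμ ha hab hb hh Y
  have h0 := sub_nonneg.2 (pz_xi_mono hβ ha hab hb)
  have hc : pzC (Φ μ b) := pz_cls hβ hΦ hμ ⟨ha.trans hab, hb⟩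
  have hα0 := pz_distF_nonneg μ a
  have hα1 := pz_distF_le hμ a
  set h := xiD β b - xiD β a
  set f := Φ μ b
  set I1 := ∫ w, f (Y + δ + w) ∂pzG h
  set I2 := ∫ w, f (Y + w) ∂pzG h
  set p := deriv f (Y + δ)
  set u := deriv f Y
  set α := distF μ a
  have k1 := (hc.key (Y + G + δ)).1 (Y + G + D + δ)
  have k2 := (hc.key (Y + G + δ)).2 (Y + G + D + δ)
  have k3 := (hc.key (Y + G)).1 (Y + G + D)
  have k4 := (hc.key (Y + G)).2 (Y + G + D)
  rw [show Y + G + D + δ - (Y + G + δ) = D by ring] at k1 k2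
  rw [show Y + G + D - (Y + G) = D by ring] at k3 k4
  have l1 := hc.deriv_lip (Y + G + δ) (Y + δ)
  have l2 := hc.deriv_lip (Y + G) Y
  rw [show Y + G + δ - (Y + δ) = G by ring] at l1
  rw [show Y + G - Y = G by ring] at l2
  have l3 : |p - u| ≤ 2 * |δ| := by
    have := hc.deriv_lip (Y + δ) Y
    rwa [show Y + δ - Y = δ by ring] at this
  set p1 := deriv f (Y + G + δ)
  set u1 := deriv f (Y + G)
  have hsq : √h * √h = h := Real.mul_self_sqrt h0
  have hs0 := Real.sqrt_nonneg h
  have hs1 : √h ≤ 1 := Real.sqrt_le_one.2 hh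
  -- bound pieces
  have b1 : |(p1 - p) * D| ≤ 2 * |G| * h := by
    rw [abs_mul]; exact mul_le_mul l1 hD (abs_nonneg _) (by positivity)
  have b2 : |(u1 - u) * D| ≤ 2 * |G| * h := by
    rw [abs_mul]; exact mul_le_mul l2 hD (abs_nonneg _) (by positivity)
  have b3 : 2 * |G| * h ≤ √h * (G ^ 2 + h) := by
    have : 0 ≤ (|G| - √h) ^ 2 := sq_nonneg _
    have e : (|G| - √h) ^ 2 = G ^ 2 + h - 2 * |G| * √h := by
      rw [sub_sq, sq_abs, Real.sq_sqrt h0]; ring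
    have : 2 * |G| * √h ≤ G ^ 2 + h := by linarith
    calc 2 * |G| * h = √h * (2 * |G| * √h) := by linear_combination (-2 * |G|) * hsq
      _ ≤ _ := by gcongr
  have b4 : D ^ 2 ≤ h * √h := by
    have h1 : D ^ 2 ≤ h ^ 2 := by rw [← sq_abs]; exact pow_le_pow_left₀ (abs_nonneg _) hD 2
    have h2 : h ≤ √h := by
      have := mul_le_mul_of_nonneg_right hs1 hs0
      linarith only [this, hsq]
    have := mul_le_mul_of_nonneg_left h2 h0
    linarith only [h1, this]
  have b5 : |(p - u) * (D - α * h * u)| ≤ 2 * |δ| * |D - α * h * u| := by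
    rw [abs_mul]; exact mul_le_mul_of_nonneg_right l3 (abs_nonneg _)
  have b6 : α / 2 * h * (p - u) ^ 2 ≤ 2 * h * δ ^ 2 := by
    have : (p - u) ^ 2 ≤ 4 * δ ^ 2 := by
      rw [← sq_abs, ← sq_abs δ]
      have := pow_le_pow_left₀ (abs_nonneg _) l3 2
      rw [mul_pow] at this
      linarith only [this]
    have h1 : 0 ≤ α / 2 * h := by positivity
    have h2 : α / 2 * h ≤ h / 2 := by
      have := mul_le_mul_of_nonneg_right hα1 h0
      linarith only [this]
    have h3 : 0 ≤ δ ^ 2 := sq_nonneg _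
    calc α / 2 * h * (p - u) ^ 2 ≤ α / 2 * h * (4 * δ ^ 2) := by gcongr
      _ ≤ h / 2 * (4 * δ ^ 2) := by gcongr
      _ = _ := by ring
  have b7 : 0 ≤ α / 2 * h * (p - u) ^ 2 := by positivity
  have alg : (p - u) * D - α / 2 * h * (p ^ 2 - u ^ 2) = (p - u) * (D - α * h * u) - α / 2 * h * (p - u) ^ 2 := by
    ring
  rw [abs_le] at o1 o2 b1 b2 b5 ⊢
  have m1 : (p1 - u1) * D = (p1 - p) * D - (u1 - u) * D + (p - u) * D := by ring
  obtain ⟨o1, o1'⟩ := o1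
  obtain ⟨o2, o2'⟩ := o2
  obtain ⟨b1, b1'⟩ := b1
  obtain ⟨b2, b2'⟩ := b2
  obtain ⟨b5, b5'⟩ := b5
  constructor
  · linarith only [o1, o1', o2, o2', b1, b1', b2, b2', b5, b5', k1, k2, k3, k4, b3, b4, b6, b7, alg, m1]
  · linarith only [o1, o1', o2, o2', b1, b1', b2, b2', b5, b5', k1, k2, k3, k4, b3, b4, b6, b7, alg, m1]

end


/-! ### The one-step estimate in expectation -/

/-- drift increment -/
def pzD {Ω : Type*} (β : ℕ → ℝ) (B X : ℝ → Ω → ℝ) (a b : ℝ) (ω : Ω) : ℝ :=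
  X b ω - X a ω - (B (xiD β b) ω - B (xiD β a) ω)

/-- drift increment error -/
def pzE {Ω : Type*} (β : ℕ → ℝ) (Φ : Measure ℝ → ℝ → ℝ → ℝ) (μ : Measure ℝ) (B X : ℝ → Ω → ℝ)
    (a b : ℝ) (ω : Ω) : ℝ :=
  |pzD β B X a b ω - distF μ a * (xiD β b - xiD β a) * deriv (Φ μ b) (X a ω)|

section
variable {Ω : Type*} [mΩ : MeasurableSpace Ω] {P : Measure Ω} [IsProbabilityMeasure P]
    {β : ℕ → ℝ} (hβ : ValidBeta β)
    {Φ : Measure ℝ → ℝ → ℝ → ℝ} (hΦ : IsParisiFamily β Φ)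
    {B : ℝ → Ω → ℝ} (hB : IsStdBM P B)
    {𝓕 : Filtration ℝ mΩ}
    (h𝓕 : ∀ r : ℝ, (𝓕 r : MeasurableSpace Ω)
      = ⨆ v ∈ Icc (0 : ℝ) r, MeasurableSpace.comap (fun ω => B (xiD β v) ω) inferInstance)
    {μ : Measure ℝ} (hμ : MemM μ)
    {s t : ℝ} (hs : 0 ≤ s) (hst : s ≤ t) (ht : t ≤ 1) {x : ℝ}
    {X : ℝ → Ω → ℝ}
    (hXcont : ∀ ω, ContinuousOn (fun r => X r ω) (Icc s t))
    (hXadap : ∀ r ∈ Icc s t, StronglyMeasurable[𝓕 r] (X r))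
    (hX : ∀ ω, ∀ r ∈ Icc s t, X r ω
      = x + (∫ v in s..r, distF μ v * zetaFn β v * deriv (Φ μ v) (X v ω))
          + (B (xiD β r) ω - B (xiD β s) ω))

include hβ h𝓕 ht hB in
lemma pz_indep {a b : ℝ} (ha : 0 ≤ a) (hab : a ≤ b) (hb : b ≤ t) :
    Indep (MeasurableSpace.comap (fun ω => B (xiD β b) ω - B (xiD β a) ω) inferInstance) (𝓕 a) P := by
  refine indep_of_indep_of_le_right (hB.2.2.2.2 (xiD β a) (xiD β b) (pz_xi_nonneg ha)
    (pz_xi_mono hβ ha hab (hb.trans ht))) ?_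
  rw [h𝓕 a]
  refine iSup₂_le fun v hv => ?_
  exact le_iSup₂_of_le (xiD β v) ⟨pz_xi_nonneg hv.1,
    pz_xi_mono hβ hv.1 hv.2 ((hab.trans hb).trans ht)⟩ le_rfl

include hβ hΦ hμ hs ht hXcont hX

lemma pz_D_eq {a b : ℝ} (ha : s ≤ a) (hab : a ≤ b) (hb : b ≤ t) (ω : Ω) :
    pzD β B X a b ω = ∫ v in a..b, distF μ v * zetaFn β v * deriv (Φ μ v) (X v ω) := by
  unfold pzD
  rw [hX ω b ⟨ha.trans hab, hb⟩, hX ω a ⟨ha, hab.trans hb⟩]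
  have := intervalIntegral.integral_add_adjacent_intervals
    (pz_int_ok hβ hΦ hμ hs ht (hXcont ω) le_rfl ha (hab.trans hb))
    (pz_int_ok hβ hΦ hμ hs ht (hXcont ω) ha hab hb)
  rw [← this]; ring

lemma pz_D_le' {a b : ℝ} (ha : s ≤ a) (hab : a ≤ b) (hb : b ≤ t) (ω : Ω) :
    |pzD β B X a b ω| ≤ xiD β b - xiD β a := by
  rw [pz_D_eq hβ hΦ hμ hs ht hXcont hX ha hab hb]
  exact pz_D_le hβ hΦ hμ hs ht (hXcont ω) ha hab hb

lemma pz_E_le {a b : ℝ} (ha : s ≤ a) (hab : a ≤ b) (hb : b ≤ t) (ω : Ω) :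
    pzE β Φ μ B X a b ω ≤ 2 * (xiD β b - xiD β a) := by
  have h1 := pz_D_le' hβ hΦ hμ hs ht hXcont hX ha hab hb ω
  have h0 := sub_nonneg.2 (pz_xi_mono hβ (hs.trans ha) hab (hb.trans ht))
  have h2 := (pz_cls hβ hΦ hμ ⟨hs.trans (ha.trans hab), hb.trans ht⟩).deriv_le (X a ω)
  have hα0 := pz_distF_nonneg μ a
  have hα1 := pz_distF_le hμ a
  refine (abs_sub _ _).trans ?_
  have : |distF μ a * (xiD β b - xiD β a) * deriv (Φ μ b) (X a ω)| ≤ 1 * (xiD β b - xiD β a) * 1 := by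
    rw [abs_mul, abs_mul, abs_of_nonneg hα0, abs_of_nonneg h0]
    gcongr
  linarith

lemma pz_E_path {a b : ℝ} (ha : s ≤ a) (hab : a ≤ b) (hb : b ≤ t) (ω : Ω) {ε : ℝ}
    (hε : ∀ v ∈ Icc a b, |deriv (Φ μ v) (X v ω) - deriv (Φ μ a) (X a ω)| ≤ ε) :
    pzE β Φ μ B X a b ω ≤ (xiD β b - xiD β a) * (distF μ b - distF μ a)
      + (xiD β b - xiD β a) * (ε + 3 / 2 * √(xiD β b - xiD β a)) := by
  unfold pzE
  rw [pz_D_eq hβ hΦ hμ hs ht hXcont hX ha hab hb]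
  refine pz_D_bound hβ hΦ hμ hs ht (hXcont ω) ha hab hb fun v hv => ?_
  refine (abs_sub_le _ (deriv (Φ μ a) (X a ω)) _).trans (add_le_add (hε v hv) ?_)
  exact pz_deriv_time hβ hΦ hμ (hs.trans ha) hab (hb.trans ht) _

include hB hXadap

lemma pz_E_meas {a b : ℝ} (ha : s ≤ a) (hab : a ≤ b) (hb : b ≤ t) :
    Measurable (pzE β Φ μ B X a b) := by
  have hXa : Measurable (X a) := ((hXadap a ⟨ha, hab.trans hb⟩).mono (𝓕.le a)).measurable
  have hXb : Measurable (X b) := ((hXadap b ⟨ha.trans hab, hb⟩).mono (𝓕.le b)).measurable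
  have hd := (pz_cls hβ hΦ hμ (r := b) ⟨hs.trans (ha.trans hab), hb.trans ht⟩).deriv_cont.measurable
  have h1 := hB.1 (xiD β a)
  have h2 := hB.1 (xiD β b)
  unfold pzE pzD
  refine Measurable.abs ?_
  exact ((hXb.sub hXa).sub (h2.sub h1)).sub ((hd.comp hXa).const_mul _)

lemma pz_E_int {a b : ℝ} (ha : s ≤ a) (hab : a ≤ b) (hb : b ≤ t) :
    Integrable (pzE β Φ μ B X a b) P := by
  refine Integrable.of_bound (pz_E_meas hβ hΦ hB hμ hs ht hXcont hXadap hX ha hab hb).aestronglyMeasurable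
    (2 * (xiD β b - xiD β a)) (Eventually.of_forall fun ω => ?_)
  rw [Real.norm_eq_abs, pzE, abs_abs]
  exact pz_E_le hβ hΦ hμ hs ht hXcont hX ha hab hb ω

include h𝓕

lemma pz_stepE {a b : ℝ} (ha : s ≤ a) (hab : a ≤ b) (hb : b ≤ t) (hh : xiD β b - xiD β a ≤ 1) (δ : ℝ)
    {A : Set Ω} (hA : MeasurableSet[𝓕 a] A) :
    |∫ ω in A, ((Φ μ b (X b ω + δ) - Φ μ b (X b ω)) - (Φ μ a (X a ω + δ) - Φ μ a (X a ω))) ∂P|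
      ≤ 2 * |δ| * (∫ ω, pzE β Φ μ B X a b ω ∂P) + 2 * (xiD β b - xiD β a) * δ ^ 2
        + (5 + 2 * pzK) * ((xiD β b - xiD β a) * √(xiD β b - xiD β a))
        + (xiD β b - xiD β a) * (distF μ b - distF μ a) := by
  have ha0 := hs.trans ha
  have hb1 := hb.trans ht
  have h0 := sub_nonneg.2 (pz_xi_mono hβ ha0 hab hb1)
  have hca : pzC (Φ μ a) := pz_cls hβ hΦ hμ ⟨ha0, hab.trans hb1⟩
  have hcb : pzC (Φ μ b) := pz_cls hβ hΦ hμ ⟨ha0.trans hab, hb1⟩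
  have hXa' : Measurable[𝓕 a] (X a) := (hXadap a ⟨ha, hab.trans hb⟩).measurable
  have hXa : Measurable (X a) := ((hXadap a ⟨ha, hab.trans hb⟩).mono (𝓕.le a)).measurable
  have hXb : Measurable (X b) := ((hXadap b ⟨ha.trans hab, hb⟩).mono (𝓕.le b)).measurable
  have hG : Measurable (fun ω => B (xiD β b) ω - B (xiD β a) ω) := (hB.1 _).sub (hB.1 _)
  have hlaw : P.map (fun ω => B (xiD β b) ω - B (xiD β a) ω) = pzG (xiD β b - xiD β a) :=
    hB.2.2.2.1 _ _ (pz_xi_nonneg ha0) (pz_xi_mono hβ ha0 hab hb1)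
  have hind := pz_indep hβ hB h𝓕 ht ha0 hab hb
  have hpw := fun ω => pz_pointwise hβ hΦ hμ hs ht ha0 hab hb1 hh δ (X a ω)
    (B (xiD β b) ω - B (xiD β a) ω) (pzD β B X a b ω) (pz_D_le' hβ hΦ hμ hs ht hXcont hX ha hab hb ω)
  have hEint := pz_E_int hβ hΦ hB hμ hs ht hXcont hXadap hX ha hab hb (P := P)
  set h := xiD β b - xiD β a with hh_def
  set G : Ω → ℝ := fun ω => B (xiD β b) ω - B (xiD β a) ω with hGdef
  have hG2i : Integrable (fun ω => G ω ^ 2) P := by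
    have h1 : Integrable (fun w : ℝ => w ^ 2) (P.map G) := by rw [hlaw]; exact pz_int_sq h
    exact h1.comp_measurable hG
  have hG2 : ∫ ω, G ω ^ 2 ∂P = h := by
    rw [← pz_var h0, ← hlaw, integral_map hG.aemeasurable (by fun_prop)]
  have hfa := hca.lip.cont
  have hfb := hcb.lip.cont
  set F : ℝ → ℝ := fun y => Φ μ b (y + δ) - Φ μ b y with hF
  set F' : ℝ → ℝ := fun y => Φ μ a (y + δ) - Φ μ a y with hF'
  have hFc : Continuous F := by fun_prop
  have hFc' : Continuous F' := by fun_prop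
  have hFb : ∀ z, |F z| ≤ |δ| := fun z => by
    have := hcb.lip (z + δ) z
    rwa [add_sub_cancel_left] at this
  have hFb' : ∀ z, |F' z| ≤ |δ| := fun z => by
    have := hca.lip (z + δ) z
    rwa [add_sub_cancel_left] at this
  have hfr := pz_freeze P (𝓕.le a) hXa' hG hlaw hind hFc hFb hA
  set PF : ℝ → ℝ := fun y => ∫ w, F (y + w) ∂pzG h with hPF
  have hPFm : Measurable PF := by
    have hc2 : Continuous (fun q : ℝ × ℝ => F (q.1 + q.2)) := by fun_prop
    exact (hc2.stronglyMeasurable.integral_prod_right' (ν := pzG h)).measurable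
  have hPFb : ∀ z, |PF z| ≤ |δ| := fun z => by
    have := norm_integral_le_of_norm_le_const (μ := pzG h) (f := fun w => F (z + w)) (C := |δ|)
      (Eventually.of_forall fun w => hFb _)
    simpa using this
  have hPFe : ∀ y, PF y = (∫ w, Φ μ b (y + δ + w) ∂pzG h) - ∫ w, Φ μ b (y + w) ∂pzG h := by
    intro y
    rw [← integral_sub (hcb.lip.int h (y + δ)) (hcb.lip.int h y)]
    refine integral_congr_ae (Eventually.of_forall fun w => ?_)
    simp only [hF]
    rw [add_right_comm]
  have bi : ∀ {g : ℝ → ℝ} {Z : Ω → ℝ}, Measurable g → Measurable Z → (∀ z, |g z| ≤ |δ|) →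
      Integrable (fun ω => g (Z ω)) P := fun hg hZ hb =>
    Integrable.of_bound (hg.comp hZ).aestronglyMeasurable |δ| (Eventually.of_forall fun ω => hb _)
  have i1 := bi hFc.measurable hXb hFb
  have i2 := bi hFc'.measurable hXa hFb'
  have i3 := bi hFc.measurable (hXa.add hG) hFb
  have i4 := bi hPFm hXa hPFb
  set Q : Ω → ℝ := fun ω => F (X b ω) - F' (X a ω) with hQ
  set R : Ω → ℝ := fun ω => F (X a ω + G ω) - PF (X a ω) with hR
  have iQ : Integrable Q P := i1.sub i2
  have iR : Integrable R P := i3.sub i4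
  have hR0 : ∫ ω in A, R ω ∂P = 0 := by
    have i3' : Integrable (fun ω => F (X a ω + G ω)) (P.restrict A) := i3.integrableOn
    rw [hR, integral_sub i3' i4.integrableOn, hfr, sub_self]
  have e1 : ∫ ω in A, Q ω ∂P = ∫ ω in A, (Q ω - R ω) ∂P := by
    rw [integral_sub iQ.integrableOn iR.integrableOn, hR0, sub_zero]
  show |∫ ω in A, Q ω ∂P| ≤ _
  rw [e1]
  have iG : Integrable (fun ω => 2 * √h * (G ω ^ 2 + h)) P :=
    (hG2i.add (integrable_const h)).const_mul _
  have j1 : Integrable (fun ω => 2 * |δ| * pzE β Φ μ B X a b ω) P := hEint.const_mul _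
  have j2 : Integrable (fun ω => 2 * |δ| * pzE β Φ μ B X a b ω + 2 * h * δ ^ 2) P :=
    j1.add (integrable_const _)
  have j3 : Integrable (fun ω => 2 * |δ| * pzE β Φ μ B X a b ω + 2 * h * δ ^ 2
      + 2 * √h * (G ω ^ 2 + h)) P := j2.add iG
  have j4 : Integrable (fun ω => 2 * |δ| * pzE β Φ μ B X a b ω + 2 * h * δ ^ 2
      + 2 * √h * (G ω ^ 2 + h) + (1 + 2 * pzK) * (h * √h)) P := j3.add (integrable_const _)
  have ibd : Integrable (fun ω => 2 * |δ| * pzE β Φ μ B X a b ω + 2 * h * δ ^ 2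
      + 2 * √h * (G ω ^ 2 + h) + (1 + 2 * pzK) * (h * √h) + h * (distF μ b - distF μ a)) P :=
    j4.add (integrable_const _)
  calc |∫ ω in A, (Q ω - R ω) ∂P| ≤ ∫ ω in A, |Q ω - R ω| ∂P := abs_integral_le_integral_abs
    _ ≤ ∫ ω, |Q ω - R ω| ∂P :=
      setIntegral_le_integral (iQ.sub iR).abs (Eventually.of_forall fun _ => abs_nonneg _)
    _ ≤ ∫ ω, (2 * |δ| * pzE β Φ μ B X a b ω + 2 * h * δ ^ 2
      + 2 * √h * (G ω ^ 2 + h) + (1 + 2 * pzK) * (h * √h) + h * (distF μ b - distF μ a)) ∂P := by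
      refine integral_mono (iQ.sub iR).abs ibd fun ω => ?_
      have := hpw ω
      have e : X a ω + G ω + pzD β B X a b ω = X b ω := by
        simp only [hGdef, pzD]; ring
      simp only [hQ, hR, hF, hF', hPFe]
      rw [show X a ω + (B (xiD β b) ω - B (xiD β a) ω) + pzD β B X a b ω = X b ω from e] at this
      exact this
    _ = _ := by
      rw [integral_add j4 (integrable_const _), integral_add j3 (integrable_const _),
        integral_add j2 iG, integral_add j1 (integrable_const _), integral_const_mul,
        integral_const_mul (2 * √h), integral_add hG2i (integrable_const h), hG2]
      simp
      ring

end


/-! ### Summation along partitions and conclusion -/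

/-- uniform partition -/
def pzP (a b : ℝ) (n i : ℕ) : ℝ := a + (b - a) * ((i : ℝ) / n)

lemma pzP_zero (a b : ℝ) (n : ℕ) : pzP a b n 0 = a := by simp [pzP]

lemma pzP_last (a b : ℝ) {n : ℕ} (hn : 0 < n) : pzP a b n n = b := by
  have : (n : ℝ) ≠ 0 := by exact_mod_cast hn.ne'
  simp [pzP, this]

lemma pzP_mono {a b : ℝ} (hab : a ≤ b) (n : ℕ) : Monotone (pzP a b n) := by
  intro i j hij
  have : (i : ℝ) ≤ j := by exact_mod_cast hij
  have := sub_nonneg.2 hab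
  unfold pzP; gcongr

lemma pzP_step (a b : ℝ) (n i : ℕ) : pzP a b n (i + 1) - pzP a b n i = (b - a) / n := by
  unfold pzP; push_cast; ring

lemma pzP_ge {a b : ℝ} (hab : a ≤ b) (n i : ℕ) : a ≤ pzP a b n i := by
  have := pzP_mono hab n (Nat.zero_le i)
  rwa [pzP_zero] at this

lemma pzP_le {a b : ℝ} (hab : a ≤ b) {n i : ℕ} (hn : 0 < n) (hi : i ≤ n) : pzP a b n i ≤ b := by
  have := pzP_mono hab n hi
  rwa [pzP_last a b hn] at this

section
variable {Ω : Type*} [mΩ : MeasurableSpace Ω] {P : Measure Ω} [IsProbabilityMeasure P]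
    {β : ℕ → ℝ} (hβ : ValidBeta β)
    {Φ : Measure ℝ → ℝ → ℝ → ℝ} (hΦ : IsParisiFamily β Φ)
    {B : ℝ → Ω → ℝ} (hB : IsStdBM P B)
    {𝓕 : Filtration ℝ mΩ}
    (h𝓕 : ∀ r : ℝ, (𝓕 r : MeasurableSpace Ω)
      = ⨆ v ∈ Icc (0 : ℝ) r, MeasurableSpace.comap (fun ω => B (xiD β v) ω) inferInstance)
    {μ : Measure ℝ} (hμ : MemM μ)
    {s t : ℝ} (hs : 0 ≤ s) (hst : s ≤ t) (ht : t ≤ 1) {x : ℝ}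
    {X : ℝ → Ω → ℝ}
    (hXcont : ∀ ω, ContinuousOn (fun r => X r ω) (Icc s t))
    (hXadap : ∀ r ∈ Icc s t, StronglyMeasurable[𝓕 r] (X r))
    (hX : ∀ ω, ∀ r ∈ Icc s t, X r ω
      = x + (∫ v in s..r, distF μ v * zetaFn β v * deriv (Φ μ v) (X v ω))
          + (B (xiD β r) ω - B (xiD β s) ω))

include hβ hΦ hμ hs ht hXcont hX

lemma pz_S_tendsto {a b : ℝ} (ha : s ≤ a) (hab : a ≤ b) (hb : b ≤ t) (ω : Ω) :
    Tendsto (fun n : ℕ => ∑ i ∈ Finset.range n, pzE β Φ μ B X (pzP a b n i) (pzP a b n (i + 1)) ω)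
      atTop (nhds 0) := by
  obtain ⟨L, hL0, hL⟩ := pz_xi_lip hβ
  set H := xiD β b - xiD β a with hH
  have hH0 : 0 ≤ H := sub_nonneg.2 (pz_xi_mono hβ (hs.trans ha) hab (hb.trans ht))
  have huc := Metric.uniformContinuousOn_iff.1 (isCompact_Icc.uniformContinuousOn_of_continuous
    (pz_V_cont hβ hΦ hμ hs ht (hXcont ω)))
  have hηt : Tendsto (fun n : ℕ => L * ((b - a) / n)) atTop (nhds 0) := by
    simpa using (tendsto_const_div_atTop_nhds_zero_nat (b - a)).const_mul L
  have hst0 : Tendsto (fun n : ℕ => L * ((b - a) / n) + H * (3 / 2 * √(L * ((b - a) / n)))) atTop (nhds 0) := by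
    have := hηt.add (((hηt.sqrt).const_mul (3 / 2)).const_mul H)
    simpa using this
  rw [Metric.tendsto_atTop']
  intro ε hε
  obtain ⟨ρ, hρ, hV⟩ := huc (ε / (2 * (H + 1))) (by positivity)
  have ev1 := (tendsto_const_div_atTop_nhds_zero_nat (b - a)).eventually (gt_mem_nhds hρ)
  have ev2 := hst0.eventually (gt_mem_nhds (half_pos hε))
  obtain ⟨N, hN⟩ := eventually_atTop.1 ((ev1.and ev2).and (eventually_gt_atTop 0))
  refine ⟨N, fun n hn => ?_⟩
  obtain ⟨⟨h1, h2⟩, h3⟩ := hN n hn.le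
  have hn0 : 0 ≤ ∑ i ∈ Finset.range n, pzE β Φ μ B X (pzP a b n i) (pzP a b n (i + 1)) ω :=
    Finset.sum_nonneg fun i _ => abs_nonneg _
  rw [Real.dist_eq, sub_zero, abs_of_nonneg hn0]
  set η := L * ((b - a) / n) with hη
  have hη0 : 0 ≤ η := by have := sub_nonneg.2 hab; positivity
  have key : ∀ i ∈ Finset.range n, pzE β Φ μ B X (pzP a b n i) (pzP a b n (i + 1)) ω ≤
      η * (distF μ (pzP a b n (i + 1)) - distF μ (pzP a b n i)) +
      (xiD β (pzP a b n (i + 1)) - xiD β (pzP a b n i)) * (ε / (2 * (H + 1)) + 3 / 2 * √η) := by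
    intro i hi
    have hi' : i + 1 ≤ n := Finset.mem_range.1 hi
    have hm := pzP_mono hab n (Nat.le_succ i)
    have hlo := pzP_ge hab n i
    have hup := pzP_le hab h3 hi'
    have hd := pzP_step a b n i
    have hle := hL _ _ (hs.trans (ha.trans hlo)) hm (hup.trans (hb.trans ht))
    have hge := sub_nonneg.2 (pz_xi_mono hβ (hs.trans (ha.trans hlo)) hm (hup.trans (hb.trans ht)))
    rw [Nat.succ_eq_add_one] at hle hge hm
    rw [hd] at hle
    have hα := sub_nonneg.2 (pz_distF_mono hμ hm)
    refine (pz_E_path hβ hΦ hμ hs ht hXcont hX (ha.trans hlo) hm (hup.trans hb) ω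
      (ε := ε / (2 * (H + 1))) fun v hv => ?_).trans ?_
    · refine (hV v ⟨(ha.trans hlo).trans hv.1, hv.2.trans (hup.trans hb)⟩ _
        ⟨ha.trans hlo, hm.trans (hup.trans hb)⟩ ?_).le
      rw [Real.dist_eq, abs_of_nonneg (sub_nonneg.2 hv.1)]
      linarith [hv.2]
    · gcongr
  refine (Finset.sum_le_sum key).trans_lt ?_
  rw [Finset.sum_add_distrib, ← Finset.mul_sum, ← Finset.sum_mul,
    Finset.sum_range_sub (fun i => distF μ (pzP a b n i)), Finset.sum_range_sub (fun i => xiD β (pzP a b n i)),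
    pzP_last a b h3, pzP_zero, ← hH]
  have hα1 : distF μ b - distF μ a ≤ 1 := by linarith [pz_distF_le hμ b, pz_distF_nonneg μ a]
  have q1 : η * (distF μ b - distF μ a) ≤ η := by nlinarith
  have q2 : H * (ε / (2 * (H + 1))) ≤ ε / 2 := by
    rw [mul_div_assoc', div_le_div_iff₀ (by positivity) (by norm_num)]
    nlinarith
  linarith

include hB hXadap in
lemma pz_S_int {a b : ℝ} (ha : s ≤ a) (hab : a ≤ b) (hb : b ≤ t) :
    Tendsto (fun n : ℕ => ∑ i ∈ Finset.range n, ∫ ω, pzE β Φ μ B X (pzP a b n i) (pzP a b n (i + 1)) ω ∂P)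
      atTop (nhds 0) := by
  have hIntg : ∀ n, ∀ i ∈ Finset.range n, Integrable (pzE β Φ μ B X (pzP a b n i) (pzP a b n (i + 1))) P := by
    intro n i hi
    have hi' : i + 1 ≤ n := Finset.mem_range.1 hi
    exact pz_E_int hβ hΦ hB hμ hs ht hXcont hXadap hX (ha.trans (pzP_ge hab n i)) (pzP_mono hab n (Nat.le_succ i))
      ((pzP_le hab (by omega) hi').trans hb)
  have e : ∀ n : ℕ, ∑ i ∈ Finset.range n, ∫ ω, pzE β Φ μ B X (pzP a b n i) (pzP a b n (i + 1)) ω ∂P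
      = ∫ ω, ∑ i ∈ Finset.range n, pzE β Φ μ B X (pzP a b n i) (pzP a b n (i + 1)) ω ∂P := fun n =>
    (integral_finsetSum _ (hIntg n)).symm
  simp only [e]
  have h0 : (0 : ℝ) = ∫ _ω : Ω, (0 : ℝ) ∂P := by simp
  rw [h0]
  have hH0 := sub_nonneg.2 (pz_xi_mono hβ (hs.trans ha) hab (hb.trans ht))
  refine tendsto_integral_of_dominated_convergence (fun _ => 2 * (xiD β b - xiD β a)) (fun n => ?_)
    (integrable_const _) (fun n => Eventually.of_forall fun ω => ?_)
    (Eventually.of_forall fun ω => pz_S_tendsto hβ hΦ hμ hs ht hXcont hX ha hab hb ω)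
  · exact (integrable_finsetSum _ (hIntg n)).aestronglyMeasurable
  · rw [Real.norm_eq_abs, abs_of_nonneg (Finset.sum_nonneg fun i _ => abs_nonneg _)]
    rcases Nat.eq_zero_or_pos n with h | h3
    · subst h; simp; linarith
    · have key : ∀ i ∈ Finset.range n, pzE β Φ μ B X (pzP a b n i) (pzP a b n (i + 1)) ω ≤
          2 * (xiD β (pzP a b n (i + 1)) - xiD β (pzP a b n i)) := by
        intro i hi
        have hi' : i + 1 ≤ n := Finset.mem_range.1 hi
        exact pz_E_le hβ hΦ hμ hs ht hXcont hX (ha.trans (pzP_ge hab n i)) (pzP_mono hab n (Nat.le_succ i))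
          ((pzP_le hab (by omega) hi').trans hb) ω
      refine (Finset.sum_le_sum key).trans ?_
      rw [← Finset.mul_sum, Finset.sum_range_sub (fun i => xiD β (pzP a b n i)), pzP_last a b h3, pzP_zero]

include hB hXadap h𝓕

omit hX hXcont h𝓕 in
lemma pz_K_int {r : ℝ} (hr : r ∈ Icc s t) (δ : ℝ) :
    Integrable (fun ω => Φ μ r (X r ω + δ) - Φ μ r (X r ω)) P := by
  have hc : pzC (Φ μ r) := pz_cls hβ hΦ hμ ⟨hs.trans hr.1, hr.2.trans ht⟩
  have hXa : Measurable (X r) := ((hXadap r hr).mono (𝓕.le r)).measurable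
  have hf := hc.lip.cont.measurable
  refine Integrable.of_bound ((hf.comp (hXa.add_const δ)).sub (hf.comp hXa)).aestronglyMeasurable |δ|
    (Eventually.of_forall fun ω => ?_)
  have := hc.lip (X r ω + δ) (X r ω)
  rw [add_sub_cancel_left] at this
  exact this

lemma pz_total {a b : ℝ} (ha : s ≤ a) (hab : a ≤ b) (hb : b ≤ t) (δ : ℝ)
    {A : Set Ω} (hA : MeasurableSet[𝓕 a] A) :
    |∫ ω in A, ((Φ μ b (X b ω + δ) - Φ μ b (X b ω)) - (Φ μ a (X a ω + δ) - Φ μ a (X a ω))) ∂P|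
      ≤ 2 * (xiD β b - xiD β a) * δ ^ 2 := by
  obtain ⟨L, hL0, hL⟩ := pz_xi_lip hβ
  set H := xiD β b - xiD β a with hH
  have hηt : Tendsto (fun n : ℕ => L * ((b - a) / n)) atTop (nhds 0) := by
    simpa using (tendsto_const_div_atTop_nhds_zero_nat (b - a)).const_mul L
  have hlim : Tendsto (fun n : ℕ => 2 * |δ| * (∑ i ∈ Finset.range n,
      ∫ ω, pzE β Φ μ B X (pzP a b n i) (pzP a b n (i + 1)) ω ∂P) + 2 * H * δ ^ 2
      + (5 + 2 * pzK) * (H * √(L * ((b - a) / n))) + L * ((b - a) / n)) atTop (nhds (2 * H * δ ^ 2)) := by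
    have := ((((pz_S_int hβ hΦ hB hμ hs ht hXcont hXadap hX ha hab hb (P := P)).const_mul (2 * |δ|)).add
      (tendsto_const_nhds (x := 2 * H * δ ^ 2))).add
      (((hηt.sqrt).const_mul H).const_mul (5 + 2 * pzK))).add hηt
    simpa using this
  refine ge_of_tendsto hlim ?_
  filter_upwards [hηt.eventually (gt_mem_nhds zero_lt_one), eventually_gt_atTop 0] with n h1 h3
  set η := L * ((b - a) / n) with hη
  have hη0 : 0 ≤ η := by have := sub_nonneg.2 hab; positivity
  set K : ℕ → Ω → ℝ := fun i ω => Φ μ (pzP a b n i) (X (pzP a b n i) ω + δ) - Φ μ (pzP a b n i) (X (pzP a b n i) ω)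
    with hK
  have hKint : ∀ i, i ≤ n → Integrable (K i) P := fun i hi =>
    pz_K_int hβ hΦ hB hμ hs ht hXadap ⟨ha.trans (pzP_ge hab n i), (pzP_le hab h3 hi).trans hb⟩ δ
  have tele : ∫ ω in A, ((Φ μ b (X b ω + δ) - Φ μ b (X b ω)) - (Φ μ a (X a ω + δ) - Φ μ a (X a ω))) ∂P
      = ∑ i ∈ Finset.range n, ∫ ω in A, (K (i + 1) ω - K i ω) ∂P := by
    rw [← integral_finsetSum]
    · refine integral_congr_ae (Eventually.of_forall fun ω => ?_)
      simp only []
      rw [Finset.sum_range_sub (fun i => K i ω)]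
      simp only [hK, pzP_last a b h3, pzP_zero]
    · intro i hi
      have hi' : i + 1 ≤ n := Finset.mem_range.1 hi
      exact ((hKint _ hi').sub (hKint i (by omega))).integrableOn
  rw [tele]
  refine (Finset.abs_sum_le_sum_abs _ _).trans ?_
  have key : ∀ i ∈ Finset.range n, |∫ ω in A, (K (i + 1) ω - K i ω) ∂P| ≤
      2 * |δ| * (∫ ω, pzE β Φ μ B X (pzP a b n i) (pzP a b n (i + 1)) ω ∂P)
      + (xiD β (pzP a b n (i + 1)) - xiD β (pzP a b n i)) * (2 * δ ^ 2 + (5 + 2 * pzK) * √η)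
      + η * (distF μ (pzP a b n (i + 1)) - distF μ (pzP a b n i)) := by
    intro i hi
    have hi' : i + 1 ≤ n := Finset.mem_range.1 hi
    have hm := pzP_mono hab n (Nat.le_succ i)
    have hlo := pzP_ge hab n i
    have hup := pzP_le hab h3 hi'
    have hd := pzP_step a b n i
    have hle := hL _ _ (hs.trans (ha.trans hlo)) hm (hup.trans (hb.trans ht))
    have hge := sub_nonneg.2 (pz_xi_mono hβ (hs.trans (ha.trans hlo)) hm (hup.trans (hb.trans ht)))
    rw [Nat.succ_eq_add_one] at hle hge hm
    rw [hd] at hle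
    have hα := sub_nonneg.2 (pz_distF_mono hμ hm)
    refine (pz_stepE hβ hΦ hB h𝓕 hμ hs ht hXcont hXadap hX (ha.trans hlo) hm (hup.trans hb)
      (hle.trans h1.le) δ (𝓕.mono hlo _ hA)).trans ?_
    have hpk := pzK_nonneg
    have q1 : (xiD β (pzP a b n (i + 1)) - xiD β (pzP a b n i)) * √(xiD β (pzP a b n (i + 1)) - xiD β (pzP a b n i))
      ≤ (xiD β (pzP a b n (i + 1)) - xiD β (pzP a b n i)) * √η := by gcongr
    have q2 := mul_le_mul_of_nonneg_right hle hα
    have q3 := mul_le_mul_of_nonneg_left q1 (by positivity : 0 ≤ 5 + 2 * pzK)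
    linarith only [q2, q3]
  refine (Finset.sum_le_sum key).trans ?_
  rw [Finset.sum_add_distrib, Finset.sum_add_distrib, ← Finset.mul_sum, ← Finset.mul_sum, ← Finset.sum_mul,
    Finset.sum_range_sub (fun i => distF μ (pzP a b n i)), Finset.sum_range_sub (fun i => xiD β (pzP a b n i)),
    pzP_last a b h3, pzP_zero, ← hH]
  have hα1 : distF μ b - distF μ a ≤ 1 := by linarith [pz_distF_le hμ b, pz_distF_nonneg μ a]
  have q1 := mul_le_mul_of_nonneg_left hα1 hη0
  linarith only [q1]

omit hXcont hX h𝓕 in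
lemma pz_V_int {r : ℝ} (hr : r ∈ Icc s t) : Integrable (fun ω => deriv (Φ μ r) (X r ω)) P := by
  have hc : pzC (Φ μ r) := pz_cls hβ hΦ hμ ⟨hs.trans hr.1, hr.2.trans ht⟩
  have hXa : Measurable (X r) := ((hXadap r hr).mono (𝓕.le r)).measurable
  exact Integrable.of_bound (hc.deriv_cont.measurable.comp hXa).aestronglyMeasurable 1
    (Eventually.of_forall fun ω => hc.deriv_le _)

lemma pz_mart {a b : ℝ} (ha : s ≤ a) (hab : a ≤ b) (hb : b ≤ t) {A : Set Ω} (hA : MeasurableSet[𝓕 a] A) :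
    ∫ ω in A, deriv (Φ μ a) (X a ω) ∂P = ∫ ω in A, deriv (Φ μ b) (X b ω) ∂P := by
  have hra : a ∈ Icc s t := ⟨ha, hab.trans hb⟩
  have hrb : b ∈ Icc s t := ⟨ha.trans hab, hb⟩
  have hca : pzC (Φ μ a) := pz_cls hβ hΦ hμ ⟨hs.trans hra.1, hra.2.trans ht⟩
  have hcb : pzC (Φ μ b) := pz_cls hβ hΦ hμ ⟨hs.trans hrb.1, hrb.2.trans ht⟩
  have ia : Integrable (fun ω => deriv (Φ μ a) (X a ω)) P := pz_V_int hβ hΦ hB hμ hs ht hXadap hra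
  have ib : Integrable (fun ω => deriv (Φ μ b) (X b ω)) P := pz_V_int hβ hΦ hB hμ hs ht hXadap hrb
  have hH0 := sub_nonneg.2 (pz_xi_mono hβ (hs.trans ha) hab (hb.trans ht))
  set H := xiD β b - xiD β a with hH
  have keyf : ∀ {f : ℝ → ℝ}, pzC f → ∀ y δ, |f (y + δ) - f y - δ * deriv f y| ≤ δ ^ 2 := by
    intro f hf y δ
    have h1 := (hf.key y).1 (y + δ)
    have h2 := (hf.key y).2 (y + δ)
    rw [add_sub_cancel_left] at h1 h2
    rw [abs_le]; constructor <;> nlinarith [sq_nonneg δ]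
  have main : ∀ δ : ℝ, 0 < δ →
      |(∫ ω in A, deriv (Φ μ b) (X b ω) ∂P) - ∫ ω in A, deriv (Φ μ a) (X a ω) ∂P| ≤ (2 * H + 2) * δ := by
    intro δ hδ
    have htot := pz_total hβ hΦ hB h𝓕 hμ hs ht hXcont hXadap hX ha hab hb δ hA (P := P)
    rw [← hH] at htot
    have ka := pz_K_int hβ hΦ hB hμ hs ht hXadap hra δ (P := P)
    have kb := pz_K_int hβ hΦ hB hμ hs ht hXadap hrb δ (P := P)
    have e : δ * ((∫ ω in A, deriv (Φ μ b) (X b ω) ∂P) - ∫ ω in A, deriv (Φ μ a) (X a ω) ∂P)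
        = (∫ ω in A, ((Φ μ b (X b ω + δ) - Φ μ b (X b ω)) - (Φ μ a (X a ω + δ) - Φ μ a (X a ω))) ∂P)
          - (∫ ω in A, (Φ μ b (X b ω + δ) - Φ μ b (X b ω) - δ * deriv (Φ μ b) (X b ω)) ∂P)
          + ∫ ω in A, (Φ μ a (X a ω + δ) - Φ μ a (X a ω) - δ * deriv (Φ μ a) (X a ω)) ∂P := by
      rw [integral_sub kb.integrableOn ka.integrableOn, integral_sub kb.integrableOn (ib.const_mul δ).integrableOn,
        integral_sub ka.integrableOn (ia.const_mul δ).integrableOn, integral_const_mul, integral_const_mul]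
      ring
    have bd : ∀ (g : Ω → ℝ), (∀ ω, |g ω| ≤ δ ^ 2) → |∫ ω in A, g ω ∂P| ≤ δ ^ 2 := by
      intro g hg
      have := norm_setIntegral_le_of_norm_le_const (μ := P) (s := A) (f := g) (C := δ ^ 2)
        (measure_lt_top P A) fun ω _ => hg ω
      refine this.trans ?_
      have : P.real A ≤ 1 := measureReal_le_one
      nlinarith [sq_nonneg δ]
    have b1 := bd _ fun ω => keyf hcb (X b ω) δ
    have b2 := bd _ fun ω => keyf hca (X a ω) δ
    have : |δ * ((∫ ω in A, deriv (Φ μ b) (X b ω) ∂P) - ∫ ω in A, deriv (Φ μ a) (X a ω) ∂P)|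
        ≤ (2 * H + 2) * δ * δ := by
      rw [e]
      refine (abs_add_le _ _).trans ?_
      have := abs_sub (∫ ω in A, ((Φ μ b (X b ω + δ) - Φ μ b (X b ω)) - (Φ μ a (X a ω + δ) - Φ μ a (X a ω))) ∂P)
        (∫ ω in A, (Φ μ b (X b ω + δ) - Φ μ b (X b ω) - δ * deriv (Φ μ b) (X b ω)) ∂P)
      nlinarith
    rw [abs_mul, abs_of_pos hδ, mul_comm] at this
    exact le_of_mul_le_mul_right this hδ
  have hz : |(∫ ω in A, deriv (Φ μ b) (X b ω) ∂P) - ∫ ω in A, deriv (Φ μ a) (X a ω) ∂P| ≤ 0 := by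
    refine le_of_forall_pos_le_add fun ε hε => ?_
    have := main (ε / (2 * H + 2)) (by positivity)
    rw [mul_div_cancel₀ _ (by positivity)] at this
    linarith
  have := abs_nonpos_iff.1 hz
  linarith

end

/-- **Lemma 2, equation (16).** Along the SDE solution `X`, the process
`r ↦ ∂ₓΦ_μ(r, X(r))` is a continuous `(𝓕_r)`-martingale on `[s,t]`: it is
adapted, integrable and `E[∂ₓΦ_μ(b, X(b)) | 𝓕_a] = ∂ₓΦ_μ(a, X(a))` a.s. for
all `s ≤ a ≤ b ≤ t`. -/
theorem stmt18 {Ω : Type*} [mΩ : MeasurableSpace Ω] (P : Measure Ω) [IsProbabilityMeasure P]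
    (β : ℕ → ℝ) (hβ : ValidBeta β)
    (Φ : Measure ℝ → ℝ → ℝ → ℝ) (hΦ : IsParisiFamily β Φ)
    (B : ℝ → Ω → ℝ) (hB : IsStdBM P B)
    (𝓕 : Filtration ℝ mΩ)
    (h𝓕 : ∀ r : ℝ, (𝓕 r : MeasurableSpace Ω)
      = ⨆ v ∈ Icc (0 : ℝ) r, MeasurableSpace.comap (fun ω => B (xiD β v) ω) inferInstance)
    (μ : Measure ℝ) (hμ : MemM μ)
    (s t : ℝ) (hs : 0 ≤ s) (hst : s ≤ t) (ht : t ≤ 1) (x : ℝ)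
    (X : ℝ → Ω → ℝ)
    (hXcont : ∀ ω, ContinuousOn (fun r => X r ω) (Icc s t))
    (hXadap : ∀ r ∈ Icc s t, StronglyMeasurable[𝓕 r] (X r))
    (hX : ∀ ω, ∀ r ∈ Icc s t, X r ω
      = x + (∫ v in s..r, distF μ v * zetaFn β v * deriv (Φ μ v) (X v ω))
          + (B (xiD β r) ω - B (xiD β s) ω)) :
    (∀ r ∈ Icc s t, StronglyMeasurable[𝓕 r] fun ω => deriv (Φ μ r) (X r ω)) ∧
    (∀ r ∈ Icc s t, Integrable (fun ω => deriv (Φ μ r) (X r ω)) P) ∧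
    (∀ a b : ℝ, s ≤ a → a ≤ b → b ≤ t →
      P[(fun ω => deriv (Φ μ b) (X b ω))|𝓕 a]
        =ᵐ[P] fun ω => deriv (Φ μ a) (X a ω)) := by
  have hsm : ∀ r ∈ Icc s t, StronglyMeasurable[𝓕 r] fun ω => deriv (Φ μ r) (X r ω) := fun r hr =>
    (pz_cls hβ hΦ hμ (r := r) ⟨hs.trans hr.1, hr.2.trans ht⟩).deriv_cont.comp_stronglyMeasurable (hXadap r hr)
  have hIntg : ∀ r ∈ Icc s t, Integrable (fun ω => deriv (Φ μ r) (X r ω)) P := fun r hr =>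
    pz_V_int hβ hΦ hB hμ hs ht hXadap hr
  refine ⟨hsm, hIntg, fun a b ha hab hb => ?_⟩
  have hra : a ∈ Icc s t := ⟨ha, hab.trans hb⟩
  have hrb : b ∈ Icc s t := ⟨ha.trans hab, hb⟩
  refine (ae_eq_condExp_of_forall_setIntegral_eq (𝓕.le a) (hIntg b hrb)
    (fun A _ _ => (hIntg a hra).integrableOn)
    (fun A hA _ => pz_mart hβ hΦ hB h𝓕 hμ hs ht hXcont hXadap hX ha hab hb hA)
    (hsm a hra).aestronglyMeasurable).symm


end
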